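/- arXiv:2207.08956 — 5 statements merged into one kernel-verified Lean document; each statement's English description precedes it below -/
import Mathlib

section
/- With IX parameters γ_t = η/2 for all t, for any comparator policy π* ∈ Δ_𝒜 and any learning rate η > 0, the expected regret of Exp3-IX satisfies E[R(π*)] ≤ (log K)/η + (η/2) · Σ_{t=1}^n Σ_{a∈𝒜} r_t(a)·π*(a)/(π_B(a) + η/2). -/
open MeasureTheory ProbabilityTheory

theorem ix_exp_bound (p η r : ℝ) (hp : 0 < p) (hη : 0 < η) (h0 : 0 ≤ r) (h1 : r ≤ 1) :
    Real.exp (η * (r / (p + η / 2))) ≤ 1 + η * (r / p) := by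
  have hx : 0 ≤ η * (r / p) := by positivity
  have h := Real.le_log_one_add_of_nonneg hx
  have h2 : η * (r / (p + η / 2)) ≤ 2 * (η * (r / p)) / (η * (r / p) + 2) := by
    have e : 2 * (η * (r / p)) / (η * (r / p) + 2) = η * (r / (p + η * r / 2)) := by
      have : p + η * r / 2 ≠ 0 := by positivity
      have : η * r + p * 2 ≠ 0 := by positivity
      have : η * (r / p) + 2 ≠ 0 := by positivity
      field_simp
      try ring
    rw [e]
    have : 0 ≤ η * r := by positivity
    gcongr
    nlinarith
  calc _ ≤ Real.exp (Real.log (1 + η * (r / p))) := Real.exp_le_exp.mpr (h2.trans h)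
    _ = _ := Real.exp_log (by linarith)

/-- Theorem 1, first bound. With IX parameters `γ_t = η/2`, for any
comparator policy `π* ∈ Δ_𝒜` and any learning rate `η > 0`, the expected regret of
Exp3-IX run on off-policy feedback from behavior policy `π_B` satisfies
`E[R(π*)] ≤ (log K)/η + (η/2)·∑_{t<n} ∑_a r_t(a)·π*(a)/(π_B(a) + η/2)`. -/
theorem exp3_ix_regret_bound
    {Ω : Type*} [MeasurableSpace Ω] (μ : Measure Ω) [IsProbabilityMeasure μ]
    {𝒜 : Type*} [Fintype 𝒜] [DecidableEq 𝒜] [MeasurableSpace 𝒜] [MeasurableSingletonClass 𝒜]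
    (K : ℕ) (hK : K = Fintype.card 𝒜) (hK2 : 2 ≤ K)
    (n : ℕ) (r : ℕ → 𝒜 → ℝ) (hr : ∀ t a, r t a ∈ Set.Icc (0 : ℝ) 1)
    (πB : 𝒜 → ℝ) (hπB_pos : ∀ a, 0 < πB a) (hπB_sum : ∑ a, πB a = 1)
    (AB : ℕ → Ω → 𝒜) (hAB_meas : ∀ t, Measurable (AB t))
    (hAB_indep : iIndepFun AB μ)
    (hAB_law : ∀ t a, μ {ω | AB t ω = a} = ENNReal.ofReal (πB a))
    (η : ℝ) (hη : 0 < η)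
    (πstar : 𝒜 → ℝ) (hπstar_nonneg : ∀ a, 0 ≤ πstar a) (hπstar_sum : ∑ a, πstar a = 1)
    (rtil : ℕ → 𝒜 → Ω → ℝ)
    (hrtil : ∀ t a ω, rtil t a ω = r t a * (if AB t ω = a then 1 else 0) / (πB a + η / 2))
    (w : ℕ → 𝒜 → Ω → ℝ)
    (hw : ∀ t a ω, w t a ω = Real.exp (η * ∑ k ∈ Finset.range t, rtil k a ω))
    (pol : ℕ → 𝒜 → Ω → ℝ)
    (hpol : ∀ t a ω, pol t a ω = w t a ω / ∑ a', w t a' ω) :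
    ∑ t ∈ Finset.range n, ∑ a, (πstar a - ∫ ω, pol t a ω ∂μ) * r t a ≤
      Real.log K / η +
        η / 2 * ∑ t ∈ Finset.range n, ∑ a, r t a * πstar a / (πB a + η / 2) := by
  have hne : Nonempty 𝒜 := Fintype.card_pos_iff.mp (by omega)
  have hwpos : ∀ t a ω, 0 < w t a ω := fun t a ω => by rw [hw]; exact Real.exp_pos _
  have hWpos : ∀ t ω, 0 < ∑ a, w t a ω := fun t ω =>
    Finset.sum_pos (fun a _ => hwpos t a ω) Finset.univ_nonempty
  have hpol0 : ∀ t a ω, 0 ≤ pol t a ω := fun t a ω => by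
    rw [hpol]; exact div_nonneg (hwpos t a ω).le (hWpos t ω).le
  have hpolsum : ∀ t ω, ∑ a, pol t a ω = 1 := fun t ω => by
    simp_rw [hpol, ← Finset.sum_div]; exact div_self (hWpos t ω).ne'
  have hpol1 : ∀ t a ω, pol t a ω ≤ 1 := fun t a ω => by
    rw [← hpolsum t ω]
    exact Finset.single_le_sum (f := fun a => pol t a ω) (fun a _ => hpol0 t a ω)
      (Finset.mem_univ a)
  let I : ℕ → 𝒜 → Ω → ℝ := fun t a ω => if AB t ω = a then 1 else 0
  -- one-step bound
  have hstep : ∀ t ω, Real.log (∑ a, w (t+1) a ω) - Real.log (∑ a, w t a ω) ≤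
      η * ∑ a, pol t a ω * I t a ω * (r t a / πB a) := by
    intro t ω
    rw [← Real.log_div (hWpos _ _).ne' (hWpos _ _).ne']
    have h1 : (∑ a, w (t+1) a ω) / (∑ a, w t a ω) ≤
        1 + η * ∑ a, pol t a ω * I t a ω * (r t a / πB a) := by
      rw [Finset.sum_div]
      calc ∑ a, w (t+1) a ω / (∑ a, w t a ω)
          ≤ ∑ a, (pol t a ω + η * (pol t a ω * I t a ω * (r t a / πB a))) := by
            refine Finset.sum_le_sum fun a _ => ?_
            have e : w (t+1) a ω / (∑ a, w t a ω) = pol t a ω * Real.exp (η * rtil t a ω) := by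
              rw [hpol, hw (t+1), hw t a, Finset.sum_range_succ, mul_add, Real.exp_add]
              ring
            have h2 : Real.exp (η * rtil t a ω) ≤ 1 + η * (I t a ω * (r t a / πB a)) := by
              rw [hrtil]
              by_cases h : AB t ω = a
              · simpa [I, h] using
                  ix_exp_bound (πB a) η (r t a) (hπB_pos a) hη (hr t a).1 (hr t a).2
              · simp [I, h]
            rw [e]
            have := mul_le_mul_of_nonneg_left h2 (hpol0 t a ω)
            linarith
        _ = _ := by rw [Finset.sum_add_distrib, hpolsum, Finset.mul_sum]
    have h3 := Real.log_le_sub_one_of_pos (div_pos (hWpos (t+1) ω) (hWpos t ω))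
    linarith
  have hlow : ∀ a ω, η * ∑ k ∈ Finset.range n, rtil k a ω ≤ Real.log (∑ a, w n a ω) := by
    intro a ω
    rw [Real.le_log_iff_exp_le (hWpos n ω), ← hw]
    exact Finset.single_le_sum (f := fun a => w n a ω) (fun a _ => (hwpos n a ω).le)
      (Finset.mem_univ a)
  have hpath : ∀ ω, ∑ t ∈ Finset.range n, ∑ a, πstar a * (r t a / (πB a + η / 2)) * I t a ω ≤
      Real.log K / η +
        ∑ t ∈ Finset.range n, ∑ a, (r t a / πB a) * (pol t a ω * I t a ω) := by
    intro ω
    have h0 : Real.log (∑ a, w 0 a ω) = Real.log K := by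
      simp [hw, hK]
    have htel := Finset.sum_range_sub (fun t => Real.log (∑ a, w t a ω)) n
    have hs := Finset.sum_le_sum fun t (_ : t ∈ Finset.range n) => hstep t ω
    rw [htel, h0, ← Finset.mul_sum] at hs
    have hl : ∑ a, πstar a * (η * ∑ k ∈ Finset.range n, rtil k a ω) ≤
        Real.log (∑ a, w n a ω) := by
      calc _ ≤ ∑ a, πstar a * Real.log (∑ a, w n a ω) :=
            Finset.sum_le_sum fun a _ => mul_le_mul_of_nonneg_left (hlow a ω) (hπstar_nonneg a)
        _ = _ := by rw [← Finset.sum_mul, hπstar_sum, one_mul]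
    have e1 : ∑ a, πstar a * (η * ∑ k ∈ Finset.range n, rtil k a ω) =
        η * ∑ t ∈ Finset.range n, ∑ a, πstar a * (r t a / (πB a + η / 2)) * I t a ω := by
      rw [Finset.sum_comm, Finset.mul_sum]
      refine Finset.sum_congr rfl fun a _ => ?_
      simp_rw [Finset.mul_sum]
      refine Finset.sum_congr rfl fun t _ => ?_
      rw [hrtil]
      simp only [I]
      ring
    have e2 : ∑ t ∈ Finset.range n, ∑ a, (r t a / πB a) * (pol t a ω * I t a ω) =
        ∑ t ∈ Finset.range n, ∑ a, pol t a ω * I t a ω * (r t a / πB a) :=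
      Finset.sum_congr rfl fun t _ => Finset.sum_congr rfl fun a _ => by ring
    rw [e1] at hl
    rw [e2]
    refine le_of_mul_le_mul_left ?_ hη
    rw [mul_add, mul_div_cancel₀ _ hη.ne']
    linarith
  -- probabilistic part
  have hIset : ∀ t a, MeasurableSet {ω | AB t ω = a} := fun t a =>
    hAB_meas t (measurableSet_singleton a)
  have hImeas : ∀ t a, Measurable (I t a) := fun t a =>
    Measurable.ite (hIset t a) measurable_const measurable_const
  have hIint : ∀ t a, ∫ ω, I t a ω ∂μ = πB a := by
    intro t a
    have : I t a = Set.indicator {ω | AB t ω = a} 1 := by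
      ext ω; simp [I, Set.indicator_apply]
    rw [this, integral_indicator_one (hIset t a), Measure.real, hAB_law,
      ENNReal.toReal_ofReal (hπB_pos a).le]
  have hrtilmeas : ∀ t a, Measurable (rtil t a) := fun t a => by
    have : rtil t a = fun ω => r t a * I t a ω / (πB a + η / 2) := funext fun ω => hrtil t a ω
    rw [this]
    exact ((hImeas t a).const_mul _).div_const _
  have hwmeas : ∀ t a, Measurable (w t a) := fun t a => by
    have : w t a = fun ω => Real.exp (η * ∑ k ∈ Finset.range t, rtil k a ω) :=
      funext fun ω => hw t a ω
    rw [this]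
    exact ((Finset.measurable_sum _ fun k _ => hrtilmeas k a).const_mul _).exp
  have hpolmeas : ∀ t a, Measurable (pol t a) := fun t a => by
    have : pol t a = fun ω => w t a ω / ∑ a', w t a' ω := funext fun ω => hpol t a ω
    rw [this]
    exact (hwmeas t a).div (Finset.measurable_sum _ fun k _ => hwmeas t k)
  have hI01 : ∀ t a ω, 0 ≤ I t a ω ∧ I t a ω ≤ 1 := fun t a ω => by
    simp only [I]; split_ifs <;> norm_num
  have hIi : ∀ t a, Integrable (I t a) μ := fun t a =>
    Integrable.of_bound (hImeas t a).aestronglyMeasurable 1 (Filter.Eventually.of_forall fun ω => by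
      rw [Real.norm_eq_abs, abs_of_nonneg (hI01 t a ω).1]; exact (hI01 t a ω).2)
  have hpIi : ∀ t a, Integrable (fun ω => pol t a ω * I t a ω) μ := fun t a =>
    Integrable.of_bound ((hpolmeas t a).mul (hImeas t a)).aestronglyMeasurable 1
      (Filter.Eventually.of_forall fun ω => by
        rw [Real.norm_eq_abs, abs_of_nonneg (mul_nonneg (hpol0 t a ω) (hI01 t a ω).1)]
        exact mul_le_one₀ (hpol1 t a ω) (hI01 t a ω).1 (hI01 t a ω).2)
  have hind : ∀ t a, ∫ ω, pol t a ω * I t a ω ∂μ = (∫ ω, pol t a ω ∂μ) * πB a := by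
    intro t a
    have h := hAB_indep.indepFun_finset (Finset.range t) {t} (by simp) hAB_meas
    let G : 𝒜 → (Finset.range t → 𝒜) → ℝ := fun b x =>
      Real.exp (η * ∑ k : Finset.range t,
        r k b * (if x k = b then 1 else 0) / (πB b + η / 2))
    let F : (Finset.range t → 𝒜) → ℝ := fun x => G a x / ∑ b, G b x
    let H : (({t} : Finset ℕ) → 𝒜) → ℝ := fun x =>
      if x ⟨t, Finset.mem_singleton_self t⟩ = a then 1 else 0
    have h2 := h.comp (φ := F) (ψ := H) (measurable_of_finite F) (measurable_of_finite H)
    have hG : ∀ b ω, w t b ω = G b (fun i => AB i ω) := by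
      intro b ω
      rw [hw]
      simp only [G, hrtil]
      rw [← Finset.sum_coe_sort]
    have hF : (F ∘ fun ω (i : Finset.range t) => AB i ω) = pol t a := by
      ext ω
      simp only [Function.comp, F, hpol, hG]
    have hH : (H ∘ fun ω (i : ({t} : Finset ℕ)) => AB i ω) = I t a := by
      ext ω
      simp only [Function.comp, H, I]
    rw [hF, hH] at h2
    rw [← hIint t a]
    exact h2.integral_fun_mul_eq_mul_integral (hpolmeas t a).aestronglyMeasurable
      (hImeas t a).aestronglyMeasurable
  have hmono := integral_mono (μ := μ)
    (integrable_finsetSum _ fun t _ => integrable_finsetSum _ fun a _ => (hIi t a).const_mul _)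
    ((integrable_const _).add
      (integrable_finsetSum _ fun t _ => integrable_finsetSum _ fun a _ => (hpIi t a).const_mul _))
    hpath
  have eL : ∫ ω, ∑ t ∈ Finset.range n, ∑ a, πstar a * (r t a / (πB a + η / 2)) * I t a ω ∂μ =
      ∑ t ∈ Finset.range n, ∑ a, πstar a * (r t a / (πB a + η / 2)) * πB a := by
    rw [integral_finsetSum _ fun t _ => integrable_finsetSum _ fun a _ => (hIi t a).const_mul _]
    refine Finset.sum_congr rfl fun t _ => ?_
    rw [integral_finsetSum _ fun a _ => (hIi t a).const_mul _]
    refine Finset.sum_congr rfl fun a _ => ?_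
    rw [integral_const_mul, hIint]
  have eR : ∫ ω, (Real.log K / η +
        ∑ t ∈ Finset.range n, ∑ a, (r t a / πB a) * (pol t a ω * I t a ω)) ∂μ =
      Real.log K / η + ∑ t ∈ Finset.range n, ∑ a, (∫ ω, pol t a ω ∂μ) * r t a := by
    rw [integral_add (integrable_const _) (integrable_finsetSum _ fun t _ =>
      integrable_finsetSum _ fun a _ => (hpIi t a).const_mul _),
      integral_finsetSum _ fun t _ => integrable_finsetSum _ fun a _ => (hpIi t a).const_mul _]
    congr 1
    · simp
    refine Finset.sum_congr rfl fun t _ => ?_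
    rw [integral_finsetSum _ fun a _ => (hpIi t a).const_mul _]
    refine Finset.sum_congr rfl fun a _ => ?_
    rw [integral_const_mul, hind]
    have := (hπB_pos a).ne'
    field_simp
  have hfin := eL.symm.le.trans (hmono.trans eR.le)
  have e3 : ∑ t ∈ Finset.range n, ∑ a, (πstar a - ∫ ω, pol t a ω ∂μ) * r t a =
      ∑ t ∈ Finset.range n, ∑ a, πstar a * (r t a / (πB a + η / 2)) * πB a
      + η / 2 * ∑ t ∈ Finset.range n, ∑ a, r t a * πstar a / (πB a + η / 2)
      - ∑ t ∈ Finset.range n, ∑ a, (∫ ω, pol t a ω ∂μ) * r t a := by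
    simp_rw [Finset.mul_sum, ← Finset.sum_add_distrib, ← Finset.sum_sub_distrib]
    refine Finset.sum_congr rfl fun t _ => Finset.sum_congr rfl fun a _ => ?_
    have h1 : πB a + η / 2 ≠ 0 := by have := hπB_pos a; positivity
    have h2 : πstar a * r t a = πstar a * (r t a / (πB a + η / 2)) * πB a +
        η / 2 * (r t a * πstar a / (πB a + η / 2)) := by
      rw [← sub_eq_zero]
      have : πstar a * (r t a / (πB a + η / 2)) * πB a +
        η / 2 * (r t a * πstar a / (πB a + η / 2)) =
        πstar a * r t a * ((πB a + η / 2) / (πB a + η / 2)) := by ring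
      rw [this, div_self h1]; ring
    rw [sub_mul, h2]
  rw [e3]
  linarith
end

section
/- With IX parameters γ_t = η/2 and the learning rate η = √(log(K)/n), for any comparator policy π* ∈ Δ_𝒜 the expected regret of Exp3-IX satisfies E[R(π*)] ≤ √(n·log K)·(1 + C(π*;π_B)/2), where C(π*;π_B) = Σ_{a∈𝒜} π*(a)/π_B(a) is the coverage ratio. -/
open MeasureTheory ProbabilityTheory

/-- Theorem 1, uniform tuning. With IX parameters `γ_t = η/2` and learning
rate `η = √(log(K)/n)`, for any comparator policy `π* ∈ Δ_𝒜` the expected regret of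
Exp3-IX satisfies `E[R(π*)] ≤ √(n·log K)·(1 + C(π*;π_B)/2)` where
`C(π*;π_B) = ∑_a π*(a)/π_B(a)`. -/
theorem exp3_ix_regret_uniform_tuning
    {Ω : Type*} [MeasurableSpace Ω] (μ : Measure Ω) [IsProbabilityMeasure μ]
    {𝒜 : Type*} [Fintype 𝒜] [DecidableEq 𝒜] [MeasurableSpace 𝒜] [MeasurableSingletonClass 𝒜]
    (K : ℕ) (hK : K = Fintype.card 𝒜) (hK2 : 2 ≤ K)
    (n : ℕ) (hn : 0 < n) (r : ℕ → 𝒜 → ℝ) (hr : ∀ t a, r t a ∈ Set.Icc (0 : ℝ) 1)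
    (πB : 𝒜 → ℝ) (hπB_pos : ∀ a, 0 < πB a) (hπB_sum : ∑ a, πB a = 1)
    (AB : ℕ → Ω → 𝒜) (hAB_meas : ∀ t, Measurable (AB t))
    (hAB_indep : iIndepFun AB μ)
    (hAB_law : ∀ t a, μ {ω | AB t ω = a} = ENNReal.ofReal (πB a))
    (η : ℝ) (hη : η = Real.sqrt (Real.log K / n))
    (πstar : 𝒜 → ℝ) (hπstar_nonneg : ∀ a, 0 ≤ πstar a) (hπstar_sum : ∑ a, πstar a = 1)
    (rtil : ℕ → 𝒜 → Ω → ℝ)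
    (hrtil : ∀ t a ω, rtil t a ω = r t a * (if AB t ω = a then 1 else 0) / (πB a + η / 2))
    (w : ℕ → 𝒜 → Ω → ℝ)
    (hw : ∀ t a ω, w t a ω = Real.exp (η * ∑ k ∈ Finset.range t, rtil k a ω))
    (pol : ℕ → 𝒜 → Ω → ℝ)
    (hpol : ∀ t a ω, pol t a ω = w t a ω / ∑ a', w t a' ω) :
    ∑ t ∈ Finset.range n, ∑ a, (πstar a - ∫ ω, pol t a ω ∂μ) * r t a ≤
      Real.sqrt (n * Real.log K) * (1 + (∑ a, πstar a / πB a) / 2) := by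
  classical
  have hη0 : 0 < η := by
    rw [hη]
    apply Real.sqrt_pos.2
    have : 0 < Real.log K := Real.log_pos (by exact_mod_cast hK2)
    positivity
  have hKpos : (0 : ℝ) < K := by
    have : 0 < K := by omega
    exact_mod_cast this
  have hne : Nonempty 𝒜 := Fintype.card_pos_iff.1 (by omega)
  -- indicator and unbiased estimates
  set ind : ℕ → 𝒜 → Ω → ℝ := fun t a ω => if AB t ω = a then 1 else 0 with hind
  set S : ℕ → Ω → ℝ := fun t ω => ∑ a, pol t a ω * (r t a * ind t a ω / πB a) with hS
  have hwpos : ∀ t a ω, 0 < w t a ω := fun t a ω => by rw [hw]; exact Real.exp_pos _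
  have hWpos : ∀ t ω, 0 < ∑ a, w t a ω := fun t ω =>
    Finset.sum_pos (fun a _ => hwpos t a ω) Finset.univ_nonempty
  have hpol0 : ∀ t a ω, 0 ≤ pol t a ω := fun t a ω => by
    rw [hpol]; exact div_nonneg (hwpos t a ω).le (hWpos t ω).le
  have hpol1 : ∀ t a ω, pol t a ω ≤ 1 := fun t a ω => by
    rw [hpol]
    apply div_le_one_of_le₀ _ (hWpos t ω).le
    exact Finset.single_le_sum (f := fun a => w t a ω) (fun a _ => (hwpos t a ω).le)
      (Finset.mem_univ a)
  have hexp : ∀ t a ω, Real.exp (η * rtil t a ω) ≤ 1 + η * (r t a * ind t a ω / πB a) := by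
    intro t a ω
    have hb := hπB_pos a
    obtain ⟨h0, h1⟩ := hr t a
    rw [hrtil]
    simp only [hind]
    split_ifs with h
    · have hx : 0 ≤ η * (r t a * 1 / πB a) := by positivity
      have hl := Real.le_log_one_add_of_nonneg hx
      rw [← Real.le_log_iff_exp_le (by positivity)]
      refine le_trans ?_ hl
      rw [show 2 * (η * (r t a * 1 / πB a)) / (η * (r t a * 1 / πB a) + 2)
        = η * (r t a / (πB a + η * r t a / 2)) by field_simp; ring]
      rw [mul_one]
      gcongr
      nlinarith
    · simp
  have hstep : ∀ t ω, ∑ a, w (t + 1) a ω ≤ (∑ a, w t a ω) * Real.exp (η * S t ω) := by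
    intro t ω
    have h1 : ∑ a, w (t + 1) a ω ≤ (∑ a, w t a ω) * (1 + η * S t ω) := by
      have : (∑ a, w t a ω) * (1 + η * S t ω)
          = ∑ a, w t a ω * (1 + η * (r t a * ind t a ω / πB a)) := by
        simp only [hS, hpol, mul_add, mul_one, Finset.sum_add_distrib, Finset.mul_sum]
        congr 1
        refine Finset.sum_congr rfl fun a _ => ?_
        have := (hWpos t ω).ne'
        field_simp
      rw [this]
      refine Finset.sum_le_sum fun a _ => ?_
      have : w (t + 1) a ω = w t a ω * Real.exp (η * rtil t a ω) := by
        rw [hw, hw, Finset.sum_range_succ, mul_add, Real.exp_add]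
      rw [this]
      exact mul_le_mul_of_nonneg_left (hexp t a ω) (hwpos t a ω).le
    refine h1.trans (mul_le_mul_of_nonneg_left ?_ (hWpos t ω).le)
    linarith [Real.add_one_le_exp (η * S t ω)]
  have hWn : ∀ t ω, ∑ a, w t a ω ≤ K * Real.exp (η * ∑ k ∈ Finset.range t, S k ω) := by
    intro t ω
    induction t with
    | zero => simp [hw, hK]
    | succ t ih =>
      rw [Finset.sum_range_succ, mul_add, Real.exp_add, ← mul_assoc]
      exact (hstep t ω).trans (mul_le_mul_of_nonneg_right ih (Real.exp_pos _).le)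
  have hpath1 : ∀ a ω, η * ∑ k ∈ Finset.range n, rtil k a ω
      ≤ Real.log K + η * ∑ k ∈ Finset.range n, S k ω := by
    intro a ω
    have h1 : w n a ω ≤ K * Real.exp (η * ∑ k ∈ Finset.range n, S k ω) :=
      (Finset.single_le_sum (f := fun a => w n a ω) (fun a _ => (hwpos n a ω).le)
        (Finset.mem_univ a)).trans (hWn n ω)
    rw [hw] at h1
    have h2 := Real.log_le_log (Real.exp_pos _) h1
    rwa [Real.log_exp, Real.log_mul hKpos.ne' (Real.exp_pos _).ne', Real.log_exp] at h2
  -- probability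
  have hmeasA : ∀ t a, MeasurableSet {ω | AB t ω = a} := fun t a =>
    hAB_meas t (measurableSet_singleton a)
  have hindeq : ∀ t a, ind t a = Set.indicator {ω | AB t ω = a} (fun _ => (1 : ℝ)) := by
    intro t a; ext ω; simp [hind, Set.indicator]
  have hindmeas : ∀ t a, Measurable (ind t a) := fun t a => by
    rw [hindeq]; exact measurable_const.indicator (hmeasA t a)
  have hindint : ∀ t a, Integrable (ind t a) μ := fun t a => by
    rw [hindeq]; exact (integrable_const (1 : ℝ)).indicator (hmeasA t a)
  have hEind : ∀ t a, ∫ ω, ind t a ω ∂μ = πB a := by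
    intro t a
    rw [hindeq, integral_indicator (hmeasA t a)]
    simp [Measure.real, hAB_law, (hπB_pos a).le]
  -- the policy is a function of the past actions
  have hpolfun : ∀ t a, ∃ g : ((i : Finset.range t) → 𝒜) → ℝ,
      pol t a = g ∘ (fun ω (i : Finset.range t) => AB i ω) := by
    intro t a
    refine ⟨fun v => Real.exp (η * ∑ k : Finset.range t,
        r k a * (if v k = a then 1 else 0) / (πB a + η / 2)) /
      ∑ a', Real.exp (η * ∑ k : Finset.range t,
        r k a' * (if v k = a' then 1 else 0) / (πB a' + η / 2)), ?_⟩
    have key : ∀ a ω, ∑ k ∈ Finset.range t, rtil k a ω = ∑ k : Finset.range t,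
        r k a * (if AB k ω = a then 1 else 0) / (πB a + η / 2) := by
      intro a ω
      rw [← Finset.sum_coe_sort]
      exact Finset.sum_congr rfl fun k _ => hrtil _ _ _
    ext ω
    simp only [hpol, hw, key, Function.comp]
  have hpastmeas : ∀ t, Measurable (fun ω (i : Finset.range t) => AB i ω) := fun t =>
    measurable_pi_lambda _ fun i => hAB_meas i
  have hpolmeas : ∀ t a, Measurable (pol t a) := by
    intro t a
    obtain ⟨g, hg⟩ := hpolfun t a
    rw [hg]
    exact (measurable_of_countable g).comp (hpastmeas t)
  have hpolint : ∀ t a, Integrable (pol t a) μ := fun t a =>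
    Integrable.of_bound (hpolmeas t a).aestronglyMeasurable 1
      (Filter.Eventually.of_forall fun ω => by
        rw [Real.norm_eq_abs, abs_of_nonneg (hpol0 t a ω)]; exact hpol1 t a ω)
  have hindep : ∀ t a, IndepFun (pol t a) (ind t a) μ := by
    intro t a
    obtain ⟨g, hg⟩ := hpolfun t a
    have h := hAB_indep.indepFun_finset (Finset.range t) {t} (by simp) hAB_meas
    have h2 : ind t a = (fun v : ((i : ({t} : Finset ℕ)) → 𝒜) =>
        if v ⟨t, Finset.mem_singleton_self t⟩ = a then (1 : ℝ) else 0) ∘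
        (fun ω (i : ({t} : Finset ℕ)) => AB i ω) := rfl
    rw [hg, h2]
    exact h.comp (measurable_of_countable g) (measurable_of_countable _)
  have hpi : ∀ t a, Integrable (fun ω => pol t a ω * ind t a ω) μ := fun t a =>
    (hindep t a).integrable_mul (hpolint t a) (hindint t a)
  have hEpi : ∀ t a, ∫ ω, pol t a ω * ind t a ω ∂μ = (∫ ω, pol t a ω ∂μ) * πB a := by
    intro t a
    rw [← hEind t a]
    exact (hindep t a).integral_fun_mul_eq_mul_integral (hpolmeas t a).aestronglyMeasurable
      (hindmeas t a).aestronglyMeasurable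
  have hSeq : ∀ t, S t = fun ω => ∑ a, (r t a / πB a) * (pol t a ω * ind t a ω) := by
    intro t; ext ω
    exact Finset.sum_congr rfl fun a _ => by ring
  have hSint : ∀ t, Integrable (S t) μ := fun t => by
    rw [hSeq]
    exact integrable_finsetSum _ fun a _ => (hpi t a).const_mul _
  have hES : ∀ t, ∫ ω, S t ω ∂μ = ∑ a, (∫ ω, pol t a ω ∂μ) * r t a := by
    intro t
    rw [hSeq, integral_finsetSum _ fun a _ => (hpi t a).const_mul _]
    refine Finset.sum_congr rfl fun a _ => ?_
    rw [integral_const_mul, hEpi]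
    have := (hπB_pos a).ne'
    field_simp
  have hrteq : ∀ t a, rtil t a = fun ω => (r t a / (πB a + η / 2)) * ind t a ω := by
    intro t a; ext ω; rw [hrtil]; simp only [hind]; ring
  have hrtint : ∀ t a, Integrable (rtil t a) μ := fun t a => by
    rw [hrteq]; exact (hindint t a).const_mul _
  have hErt : ∀ t a, r t a - η / 2 / πB a ≤ ∫ ω, rtil t a ω ∂μ := by
    intro t a
    rw [hrteq, integral_const_mul, hEind]
    have hb := hπB_pos a
    obtain ⟨h0, h1⟩ := hr t a
    have e : r t a / (πB a + η / 2) * πB a = r t a - r t a * (η / 2) / (πB a + η / 2) := by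
      field_simp; ring
    rw [e]
    have : r t a * (η / 2) / (πB a + η / 2) ≤ η / 2 / πB a := by
      gcongr
      · nlinarith
      · linarith
    linarith
  have hmain : ∀ a, η * ∑ t ∈ Finset.range n, (r t a - η / 2 / πB a)
      ≤ Real.log K + η * ∑ t ∈ Finset.range n, ∑ a, (∫ ω, pol t a ω ∂μ) * r t a := by
    intro a
    have h1 : ∫ ω, η * ∑ k ∈ Finset.range n, rtil k a ω ∂μ
        ≤ ∫ ω, (Real.log K + η * ∑ k ∈ Finset.range n, S k ω) ∂μ := by
      apply integral_mono
      · exact (integrable_finsetSum _ fun k _ => hrtint k a).const_mul _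
      · exact (integrable_const _).add
          ((integrable_finsetSum _ fun k _ => hSint k).const_mul _)
      · exact fun ω => hpath1 a ω
    rw [integral_add (integrable_const _)
        ((integrable_finsetSum _ fun k _ => hSint k).const_mul _),
      integral_const_mul, integral_const_mul, integral_finsetSum _ fun k _ => hrtint k a,
      integral_finsetSum _ fun k _ => hSint k] at h1
    simp only [hES, integral_const, probReal_univ, one_smul] at h1
    refine le_trans ?_ h1
    exact mul_le_mul_of_nonneg_left (Finset.sum_le_sum fun t _ => hErt t a) hη0.le
  set P := ∑ t ∈ Finset.range n, ∑ a, (∫ ω, pol t a ω ∂μ) * r t a with hP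
  have havg : ∑ a, πstar a * (η * ∑ t ∈ Finset.range n, (r t a - η / 2 / πB a))
      ≤ Real.log K + η * P := by
    calc _ ≤ ∑ a, πstar a * (Real.log K + η * P) :=
          Finset.sum_le_sum fun a _ => mul_le_mul_of_nonneg_left (hmain a) (hπstar_nonneg a)
      _ = _ := by rw [← Finset.sum_mul, hπstar_sum, one_mul]
  have hL : ∑ a, πstar a * (η * ∑ t ∈ Finset.range n, (r t a - η / 2 / πB a))
      = η * (∑ t ∈ Finset.range n, ∑ a, πstar a * r t a)
        - η * (n * η * ((∑ a, πstar a / πB a) / 2)) := by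
    rw [Finset.sum_comm, Finset.sum_div, Finset.mul_sum, Finset.mul_sum, Finset.mul_sum,
      ← Finset.sum_sub_distrib]
    refine Finset.sum_congr rfl fun a _ => ?_
    rw [Finset.sum_sub_distrib, ← Finset.mul_sum]
    simp only [Finset.sum_const, Finset.card_range, nsmul_eq_mul]
    ring
  have hR : ∑ t ∈ Finset.range n, ∑ a, (πstar a - ∫ ω, pol t a ω ∂μ) * r t a
      = (∑ t ∈ Finset.range n, ∑ a, πstar a * r t a) - P := by
    rw [hP, ← Finset.sum_sub_distrib]
    refine Finset.sum_congr rfl fun t _ => ?_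
    rw [← Finset.sum_sub_distrib]
    exact Finset.sum_congr rfl fun a _ => by ring
  have hnpos : (0 : ℝ) < n := by exact_mod_cast hn
  have hlog : 0 < Real.log K := Real.log_pos (by exact_mod_cast hK2)
  have hηsq : η ^ 2 = Real.log K / n := by
    rw [hη]; exact Real.sq_sqrt (by positivity)
  have hsq : Real.sqrt (n * Real.log K) = n * η := by
    rw [Real.sqrt_eq_iff_mul_self_eq (by positivity) (by positivity)]
    have : n * η * (n * η) = n ^ 2 * η ^ 2 := by ring
    rw [this, hηsq]
    field_simp
  have hlogeq : Real.log K = η * (n * η) := by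
    have : η * (n * η) = n * η ^ 2 := by ring
    rw [this, hηsq]
    field_simp
  rw [hR, hsq]
  rw [hL, hlogeq] at havg
  have : η * ((∑ t ∈ Finset.range n, ∑ a, πstar a * r t a) - P)
      ≤ η * (n * η * (1 + (∑ a, πstar a / πB a) / 2)) := by nlinarith
  exact le_of_mul_le_mul_left this hη0
end

section
/- Consider Exp3-IX with unknown behavior policy, run with learning rate η = √(log(K)/n), IX parameters γ_1 = 1 + η/2 and γ_t = η/2 + √(log(K·(t−1)²)/(2(t−1))) for t ≥ 2, and reward estimates built from the empirical estimate π̂_t of the behavior policy. Then for any comparator policy π* ∈ Δ_𝒜 the expected regret satisfies E[R(π*)] ≤ (16 + log K)/η + (η·n/2 + 2·√(n·log(K·n)))·C(π*;π_B) + 2; in particular E[R(π*)] = O(C(π*;π_B)·√(n·log(K·n))). -/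
open MeasureTheory ProbabilityTheory

lemma ew_step {η X q : ℝ} (hη : 0 < η) (hX0 : 0 ≤ X) (hX1 : X ≤ 1) (hq : 0 < q) :
    Real.exp (η * (X / (q + η / 2))) ≤ 1 + η * (X / q) := by
  have hz : 0 ≤ η * (X / q) := by positivity
  have h1 := Real.le_log_one_add_of_nonneg hz
  have h2 : η * (X / (q + η / 2)) ≤ 2 * (η * (X / q)) / (η * (X / q) + 2) := by
    have : 2 * (η * (X / q)) / (η * (X / q) + 2) = η * (X / (q + η * X / 2)) := by
      have : 0 ≤ η * X := by positivity
      have : η * X + 2 * q ≠ 0 := by positivity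
      have : q + η * X / 2 ≠ 0 := by positivity
      have : η * X / q + 2 ≠ 0 := by positivity
      field_simp
      ring
    rw [this]
    gcongr
    nlinarith
  calc _ ≤ Real.exp (Real.log (1 + η * (X / q))) := Real.exp_le_exp.mpr (h2.trans h1)
    _ = _ := Real.exp_log (by positivity)

lemma ew_regret {𝒜 : Type*} [Fintype 𝒜] [Nonempty 𝒜] (η : ℝ) (hη : 0 < η)
    (X q rt w pol : ℕ → 𝒜 → ℝ) (hX0 : ∀ t a, 0 ≤ X t a) (hX1 : ∀ t a, X t a ≤ 1)
    (hq : ∀ t a, 0 < q t a) (hrt : ∀ t a, rt t a = X t a / (q t a + η / 2))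
    (hw : ∀ t a, w t a = Real.exp (η * ∑ k ∈ Finset.range t, rt k a))
    (hpol : ∀ t a, pol t a = w t a / ∑ a', w t a')
    (p : 𝒜 → ℝ) (hp0 : ∀ a, 0 ≤ p a) (hp1 : ∑ a, p a = 1) (n : ℕ) :
    ∑ t ∈ Finset.range n, ∑ a, p a * rt t a ≤
      Real.log (Fintype.card 𝒜) / η + ∑ t ∈ Finset.range n, ∑ a, pol t a * (X t a / q t a) := by
  have hwpos : ∀ t a, 0 < w t a := fun t a => by rw [hw]; exact Real.exp_pos _
  have hWpos : ∀ t, 0 < ∑ a, w t a := fun t =>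
    Finset.sum_pos (fun a _ => hwpos t a) Finset.univ_nonempty
  have hup : ∀ m : ℕ, Real.log (∑ a, w m a) ≤ Real.log (Fintype.card 𝒜) +
      η * ∑ t ∈ Finset.range m, ∑ a, pol t a * (X t a / q t a) := by
    intro m
    induction m with
    | zero => simp [hw]
    | succ m ih =>
      set U := ∑ a, pol m a * (X m a / q m a) with hU
      have hU0 : 0 ≤ U := Finset.sum_nonneg fun a _ => by
        rw [hpol]
        have := hwpos m a; have := hWpos m; have := hX0 m a; have := hq m a
        positivity
      have h1 : ∑ a, w (m+1) a ≤ (∑ a, w m a) * (1 + η * U) := by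
        have : (∑ a, w m a) * (1 + η * U) = ∑ a, w m a * (1 + η * (X m a / q m a)) := by
          have : (∑ a, w m a) * U = ∑ a, w m a * (X m a / q m a) := by
            rw [hU, Finset.mul_sum]
            refine Finset.sum_congr rfl fun a _ => ?_
            rw [hpol]
            have := (hWpos m).ne'
            field_simp
          simp only [mul_add, mul_one, Finset.sum_add_distrib]
          rw [mul_left_comm, this, Finset.mul_sum]
          congr 1
          exact Finset.sum_congr rfl fun a _ => by ring
        rw [this]
        refine Finset.sum_le_sum fun a _ => ?_
        rw [hw (m+1), Finset.sum_range_succ, mul_add, Real.exp_add, ← hw, hrt]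
        exact mul_le_mul_of_nonneg_left (ew_step hη (hX0 _ _) (hX1 _ _) (hq _ _)) (hwpos _ _).le
      have h2 : Real.log (∑ a, w (m+1) a) ≤ Real.log (∑ a, w m a) + η * U := by
        have hpos : 0 < 1 + η * U := by positivity
        calc _ ≤ Real.log ((∑ a, w m a) * (1 + η * U)) := Real.log_le_log (hWpos _) h1
          _ = Real.log (∑ a, w m a) + Real.log (1 + η * U) :=
            Real.log_mul (hWpos _).ne' hpos.ne'
          _ ≤ _ := by
            have := Real.log_le_sub_one_of_pos hpos
            linarith
      rw [Finset.sum_range_succ, mul_add]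
      linarith
  have hlow : η * ∑ t ∈ Finset.range n, ∑ a, p a * rt t a ≤ Real.log (∑ a, w n a) := by
    rw [Finset.sum_comm, Finset.mul_sum]
    calc _ = ∑ a, p a * (η * ∑ t ∈ Finset.range n, rt t a) :=
          Finset.sum_congr rfl fun a _ => by rw [← Finset.mul_sum]; ring
      _ ≤ ∑ a, p a * Real.log (∑ a, w n a) := by
          refine Finset.sum_le_sum fun a _ => mul_le_mul_of_nonneg_left ?_ (hp0 a)
          rw [Real.le_log_iff_exp_le (hWpos n), ← hw]
          exact Finset.single_le_sum (fun b _ => (hwpos n b).le) (Finset.mem_univ a)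
      _ = _ := by rw [← Finset.sum_mul, hp1, one_mul]
  have := hlow.trans (hup n)
  have h3 : Real.log (Fintype.card 𝒜) = η * (Real.log (Fintype.card 𝒜) / η) := by field_simp
  rw [h3, ← mul_add] at this
  exact le_of_mul_le_mul_left this hη
set_option linter.unusedSectionVars false

section prob
variable {Ω : Type*} [MeasurableSpace Ω] (μ : Measure Ω) [IsProbabilityMeasure μ]
    {𝒜 : Type*} [Fintype 𝒜] [DecidableEq 𝒜] [MeasurableSpace 𝒜] [MeasurableSingletonClass 𝒜]
    (AB : ℕ → Ω → 𝒜)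

/-- `F` depends only on the first `t` observed actions. -/
def IsPast (t : ℕ) (F : Ω → ℝ) : Prop :=
  ∀ ω ω₂, (∀ k < t, AB k ω = AB k ω₂) → F ω = F ω₂

lemma past_factor {t : ℕ} {F : Ω → ℝ} (hF : IsPast AB t F) :
    ∃ G : ((Finset.range t) → 𝒜) → ℝ, F = fun ω => G (fun i => AB i ω) := by
  refine ⟨Function.extend (fun ω (i : Finset.range t) => AB i ω) F 0, ?_⟩
  funext ω
  have hfac : Function.FactorsThrough F (fun ω (i : Finset.range t) => AB i ω) := by
    intro ω ω₂ h
    refine hF ω ω₂ fun k hk => ?_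
    exact congrFun h ⟨k, Finset.mem_range.mpr hk⟩
  exact (hfac.extend_apply 0 ω).symm

lemma past_integrable (hm : ∀ t, Measurable (AB t)) {t : ℕ} {F : Ω → ℝ} (hF : IsPast AB t F) :
    Integrable F μ := by
  obtain ⟨G, rfl⟩ := past_factor AB hF
  have hmeas : Measurable fun ω => G (fun i => AB i ω) :=
    (measurable_of_finite G).comp (measurable_pi_lambda _ fun i => hm i)
  refine Integrable.of_bound hmeas.aestronglyMeasurable (∑ x, ‖G x‖) (ae_of_all _ fun ω => ?_)
  exact Finset.single_le_sum (f := fun x => ‖G x‖) (fun x _ => norm_nonneg _) (Finset.mem_univ _)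

lemma ind_integral (hm : ∀ t, Measurable (AB t)) (πB : 𝒜 → ℝ) (hπB_pos : ∀ a, 0 < πB a)
    (hlaw : ∀ t a, μ {ω | AB t ω = a} = ENNReal.ofReal (πB a)) (t : ℕ) (a : 𝒜) :
    ∫ ω, (if AB t ω = a then (1:ℝ) else 0) ∂μ = πB a := by
  have hs : MeasurableSet {ω | AB t ω = a} := hm t (measurableSet_singleton a)
  have : (fun ω => if AB t ω = a then (1:ℝ) else 0) = Set.indicator {ω | AB t ω = a} 1 := by
    funext ω; simp [Set.indicator]
  rw [this, integral_indicator_one hs, Measure.real, hlaw, ENNReal.toReal_ofReal (hπB_pos a).le]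

lemma past_mul_integral (hm : ∀ t, Measurable (AB t)) (hind : iIndepFun AB μ)
    (πB : 𝒜 → ℝ) (hπB_pos : ∀ a, 0 < πB a)
    (hlaw : ∀ t a, μ {ω | AB t ω = a} = ENNReal.ofReal (πB a))
    {t : ℕ} {F : Ω → ℝ} (hF : IsPast AB t F) (a : 𝒜) :
    ∫ ω, F ω * (if AB t ω = a then (1:ℝ) else 0) ∂μ = πB a * ∫ ω, F ω ∂μ := by
  have hint := past_integrable μ AB hm hF
  obtain ⟨G, rfl⟩ := past_factor AB hF
  have h1 := hind.indepFun_finset (Finset.range t) {t} (by simp) hm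
  have h2 := h1.comp (measurable_of_finite G)
    (measurable_of_finite (fun x : ({t} : Finset ℕ) → 𝒜 =>
      if x ⟨t, by simp⟩ = a then (1:ℝ) else 0))
  have hmeas : Measurable fun ω => (if AB t ω = a then (1:ℝ) else 0) :=
    (measurable_of_finite (fun x : 𝒜 => if x = a then (1:ℝ) else 0)).comp (hm t)
  have h3 := h2.integral_fun_mul_eq_mul_integral hint.aestronglyMeasurable
    hmeas.aestronglyMeasurable
  simp only [Function.comp_def] at h3
  rw [h3, ind_integral μ AB hm πB hπB_pos hlaw, mul_comm]

lemma hoeff (hm : ∀ t, Measurable (AB t)) (hind : iIndepFun AB μ)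
    (πB : 𝒜 → ℝ) (hπB_pos : ∀ a, 0 < πB a)
    (hlaw : ∀ t a, μ {ω | AB t ω = a} = ENNReal.ofReal (πB a))
    (t : ℕ) (ht : 1 ≤ t) (a : 𝒜) (ε : ℝ) (hε : 0 ≤ ε) :
    μ.real {ω | (∑ k ∈ Finset.range t, if AB k ω = a then (1 : ℝ) else 0) / t + ε ≤ πB a} ≤
      Real.exp (-(2 * t * ε ^ 2)) := by
  have hmf : Measurable (fun x : 𝒜 => πB a - if x = a then (1:ℝ) else 0) := measurable_of_finite _
  have hI := hind.comp (fun _ x => πB a - if x = a then (1:ℝ) else 0) (fun _ => hmf)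
  have hindI : ∀ i, Integrable (fun ω => if AB i ω = a then (1:ℝ) else 0) μ := fun i => by
    refine past_integrable μ AB hm (t := i + 1) fun ω ω₂ h => ?_
    simp [h i (by omega)]
  have hsub : ∀ i < t, HasSubgaussianMGF
      ((fun x => πB a - if x = a then (1:ℝ) else 0) ∘ AB i) ((‖πB a - (πB a - 1)‖₊ / 2) ^ 2) μ := by
    intro i _
    refine hasSubgaussianMGF_of_mem_Icc_of_integral_eq_zero (hmf.comp (hm i)).aemeasurable
      (ae_of_all _ fun ω => ?_) ?_
    · simp only [Function.comp]
      split_ifs <;> constructor <;> linarith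
    · simp only [Function.comp]
      rw [integral_sub (integrable_const _) (hindI i), ind_integral μ AB hm πB hπB_pos hlaw]
      simp
  have h := HasSubgaussianMGF.measure_sum_range_ge_le_of_iIndepFun hI hsub
    (ε := t * ε) (by positivity)
  have ht0 : (0:ℝ) < t := by exact_mod_cast ht
  refine le_trans (le_of_eq ?_) (h.trans (le_of_eq ?_))
  · congr 1
    ext ω
    simp only [Set.mem_ofPred_eq, Function.comp, Finset.sum_sub_distrib, Finset.sum_const,
      Finset.card_range, nsmul_eq_mul]
    rw [← le_sub_iff_add_le, div_le_iff₀ ht0]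
    constructor <;> intro h <;> nlinarith
  · congr 1
    have : ((((‖πB a - (πB a - 1)‖₊ / 2) ^ 2 : NNReal)) : ℝ) = 1 / 4 := by
      push_cast; simp; norm_num
    rw [this]
    field_simp
    ring
end prob

lemma sum_inv_sqrt (m : ℕ) :
    ∑ t ∈ Finset.range m, 1 / Real.sqrt ((t:ℝ) + 1) ≤ 2 * Real.sqrt m := by
  induction m with
  | zero => simp
  | succ m ih =>
    rw [Finset.sum_range_succ]
    push_cast
    have h1 : 0 < Real.sqrt ((m:ℝ) + 1) := Real.sqrt_pos.mpr (by positivity)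
    have h2 := Real.sq_sqrt (show (0:ℝ) ≤ (m:ℝ) + 1 by positivity)
    have h3 := Real.sq_sqrt (show (0:ℝ) ≤ (m:ℝ) by positivity)
    have h4 := Real.sqrt_nonneg (m:ℝ)
    have : 1 / Real.sqrt ((m:ℝ) + 1) ≤ 2 * (Real.sqrt ((m:ℝ) + 1) - Real.sqrt m) := by
      rw [div_le_iff₀ h1]
      nlinarith [sq_nonneg (Real.sqrt ((m:ℝ) + 1) - Real.sqrt m)]
    linarith

lemma sum_inv_sq (m : ℕ) : ∑ t ∈ Finset.range m, 1 / ((t:ℝ) + 1) ^ 2 ≤ 2 := by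
  suffices h : ∑ t ∈ Finset.range m, 1 / ((t:ℝ) + 1) ^ 2 ≤ 2 - 1 / (m:ℝ) by
    have : 0 ≤ 1 / (m:ℝ) := by positivity
    linarith
  induction m with
  | zero => simp
  | succ m ih =>
    rw [Finset.sum_range_succ]
    push_cast
    rcases Nat.eq_zero_or_pos m with rfl | hm
    · simp; norm_num
    · have hm' : (0:ℝ) < m := by exact_mod_cast hm
      have : 1 / ((m:ℝ) + 1) ^ 2 ≤ 1 / (m:ℝ) - 1 / ((m:ℝ) + 1) := by
        rw [div_sub_div _ _ hm'.ne' (by positivity), div_le_div_iff₀ (by positivity) (by positivity)]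
        nlinarith
      linarith

lemma tangent {h p g : ℝ} (hh : 0 ≤ h) (hp : 0 < p) (hg : 0 < g) :
    1 - g / p - p / (p + g) ^ 2 * (h - p) ≤ p * (1 / (h + g)) := by
  have h1 : p / (p + g) - p / (p + g) ^ 2 * (h - p) ≤ p * (1 / (h + g)) := by
    have : p * (1 / (h + g)) - (p / (p + g) - p / (p + g) ^ 2 * (h - p)) =
        p * (h - p) ^ 2 / ((h + g) * (p + g) ^ 2) := by
      field_simp
      ring
    have h2 : 0 ≤ p * (h - p) ^ 2 / ((h + g) * (p + g) ^ 2) := by positivity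
    linarith
  have h2 : 1 - g / p ≤ p / (p + g) := by
    have : p / (p + g) - (1 - g / p) = g ^ 2 / (p * (p + g)) := by
      field_simp
      ring
    have h2 : 0 ≤ g ^ 2 / (p * (p + g)) := by positivity
    linarith
  linarith

/-- Theorem 2: Exp3-IX with unknown behavior policy, run with learning
rate `η = √(log(K)/n)`, IX parameters `γ_1 = 1 + η/2` and
`γ_t = η/2 + √(log(K(t−1)²)/(2(t−1)))` for `t ≥ 2` (here time is 0-indexed, so round
`t` below corresponds to paper round `t+1`), and reward estimates built from the
empirical estimate `π̂_t` of the behavior policy, satisfies for any comparator `π*`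
`E[R(π*)] ≤ (16 + log K)/η + (η·n/2 + 2·√(n·log(K·n)))·C(π*;π_B) + 2`. -/
theorem exp3_ix_unknown_policy_regret_bound
    {Ω : Type*} [MeasurableSpace Ω] (μ : Measure Ω) [IsProbabilityMeasure μ]
    {𝒜 : Type*} [Fintype 𝒜] [DecidableEq 𝒜] [MeasurableSpace 𝒜] [MeasurableSingletonClass 𝒜]
    (K : ℕ) (hK : K = Fintype.card 𝒜) (hK2 : 2 ≤ K)
    (n : ℕ) (hn : 0 < n) (r : ℕ → 𝒜 → ℝ) (hr : ∀ t a, r t a ∈ Set.Icc (0 : ℝ) 1)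
    (πB : 𝒜 → ℝ) (hπB_pos : ∀ a, 0 < πB a) (hπB_sum : ∑ a, πB a = 1)
    (AB : ℕ → Ω → 𝒜) (hAB_meas : ∀ t, Measurable (AB t))
    (hAB_indep : iIndepFun AB μ)
    (hAB_law : ∀ t a, μ {ω | AB t ω = a} = ENNReal.ofReal (πB a))
    (η : ℝ) (hη : η = Real.sqrt (Real.log K / n))
    (γ : ℕ → ℝ) (hγ0 : γ 0 = 1 + η / 2)
    (hγ : ∀ t : ℕ, 1 ≤ t → γ t = η / 2 + Real.sqrt (Real.log (K * t ^ 2) / (2 * t)))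
    (πstar : 𝒜 → ℝ) (hπstar_nonneg : ∀ a, 0 ≤ πstar a) (hπstar_sum : ∑ a, πstar a = 1)
    (hatπ : ℕ → 𝒜 → Ω → ℝ)
    (hhatπ : ∀ t a ω,
      hatπ t a ω = (∑ k ∈ Finset.range t, if AB k ω = a then (1 : ℝ) else 0) / t)
    (rtil : ℕ → 𝒜 → Ω → ℝ)
    (hrtil : ∀ t a ω,
      rtil t a ω = r t a * (if AB t ω = a then 1 else 0) / (hatπ t a ω + γ t))
    (w : ℕ → 𝒜 → Ω → ℝ)
    (hw : ∀ t a ω, w t a ω = Real.exp (η * ∑ k ∈ Finset.range t, rtil k a ω))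
    (pol : ℕ → 𝒜 → Ω → ℝ)
    (hpol : ∀ t a ω, pol t a ω = w t a ω / ∑ a', w t a' ω) :
    ∑ t ∈ Finset.range n, ∑ a, (πstar a - ∫ ω, pol t a ω ∂μ) * r t a ≤
      (16 + Real.log K) / η +
        (η * n / 2 + 2 * Real.sqrt (n * Real.log (K * n))) * (∑ a, πstar a / πB a)
        + 2 := by
  obtain ⟨m, rfl⟩ : ∃ m, n = m + 1 := ⟨n - 1, by omega⟩
  have hKr : (2:ℝ) ≤ K := by exact_mod_cast hK2
  have hlogK : 0 < Real.log K := Real.log_pos (by linarith)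
  have hη0 : 0 < η := by rw [hη]; exact Real.sqrt_pos.mpr (by positivity)
  have hne : Nonempty 𝒜 := Fintype.card_pos_iff.mp (by omega)
  have hlogKt : ∀ t : ℕ, 1 ≤ t → Real.log K ≤ Real.log (K * t ^ 2) := fun t ht => by
    have : (1:ℝ) ≤ t := by exact_mod_cast ht
    exact Real.log_le_log (by linarith) (le_mul_of_one_le_right (by linarith) (one_le_pow₀ this))
  obtain ⟨ε, hεdef⟩ : ∃ ε : ℕ → ℝ, ∀ t, γ t = ε t + η / 2 :=
    ⟨fun t => γ t - η / 2, fun t => by ring⟩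
  have hε0 : ε 0 = 1 := by linarith [hεdef 0]
  have hε : ∀ t : ℕ, 1 ≤ t → ε t = Real.sqrt (Real.log (K * t ^ 2) / (2 * t)) := fun t ht => by
    linarith [hεdef t, hγ t ht]
  have hεpos : ∀ t, 0 < ε t := fun t => by
    rcases Nat.eq_zero_or_pos t with rfl | ht
    · rw [hε0]; norm_num
    · rw [hε t ht]
      have : (0:ℝ) < t := by exact_mod_cast ht
      have hl : 0 < Real.log (K * (t:ℝ) ^ 2) := hlogK.trans_le (hlogKt t ht)
      exact Real.sqrt_pos.mpr (by positivity)
  have hγpos : ∀ t, 0 < γ t := fun t => by rw [hεdef]; linarith [hεpos t]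
  have hhat0 : ∀ t a ω, 0 ≤ hatπ t a ω := fun t a ω => by
    rw [hhatπ]
    refine div_nonneg (Finset.sum_nonneg fun k _ => ?_) (by positivity)
    split_ifs <;> norm_num
  have hpB1 : ∀ a, πB a ≤ 1 := fun a => by
    rw [← hπB_sum]; exact Finset.single_le_sum (fun b _ => (hπB_pos b).le) (Finset.mem_univ a)
  -- policies are probability vectors
  have hwpos : ∀ t a ω, 0 < w t a ω := fun t a ω => by rw [hw]; exact Real.exp_pos _
  have hWpos : ∀ t ω, 0 < ∑ a, w t a ω := fun t ω =>
    Finset.sum_pos (fun a _ => hwpos t a ω) Finset.univ_nonempty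
  have hpol0 : ∀ t a ω, 0 ≤ pol t a ω := fun t a ω => by
    rw [hpol]; exact div_nonneg (hwpos _ _ _).le (hWpos _ _).le
  have hpol1 : ∀ t a ω, pol t a ω ≤ 1 := fun t a ω => by
    rw [hpol, div_le_one (hWpos _ _)]
    exact Finset.single_le_sum (fun b _ => (hwpos t b ω).le) (Finset.mem_univ a)
  -- dependence on the past
  have hhatP : ∀ t a ω ω₂, (∀ k < t, AB k ω = AB k ω₂) → hatπ t a ω = hatπ t a ω₂ := by
    intro t a ω ω₂ h
    rw [hhatπ, hhatπ]
    congr 1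
    exact Finset.sum_congr rfl fun k hk => by rw [h k (Finset.mem_range.mp hk)]
  have hrtP : ∀ t a ω ω₂, (∀ k < t + 1, AB k ω = AB k ω₂) → rtil t a ω = rtil t a ω₂ := by
    intro t a ω ω₂ h
    rw [hrtil, hrtil, hhatP t a ω ω₂ (fun k hk => h k (by omega)), h t (by omega)]
  have hwP : ∀ t a ω ω₂, (∀ k < t, AB k ω = AB k ω₂) → w t a ω = w t a ω₂ := by
    intro t a ω ω₂ h
    rw [hw, hw]
    congr 2
    refine Finset.sum_congr rfl fun k hk => hrtP k a ω ω₂ fun j hj => h j ?_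
    have := Finset.mem_range.mp hk
    omega
  have hpolP : ∀ t a ω ω₂, (∀ k < t, AB k ω = AB k ω₂) → pol t a ω = pol t a ω₂ := by
    intro t a ω ω₂ h
    rw [hpol, hpol, hwP t a ω ω₂ h]
    congr 1
    exact Finset.sum_congr rfl fun b _ => hwP t b ω ω₂ h
  have hpolI : ∀ t a, Integrable (pol t a) μ := fun t a =>
    past_integrable μ AB hAB_meas (hpolP t a)
  have hhatI : ∀ t a, Integrable (hatπ t a) μ := fun t a =>
    past_integrable μ AB hAB_meas (hhatP t a)
  have hrtI : ∀ t a, Integrable (rtil t a) μ := fun t a =>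
    past_integrable μ AB hAB_meas (hrtP t a)
  have hFP : ∀ t a, IsPast AB t (fun ω => 1 / (hatπ t a ω + γ t)) := fun t a ω ω₂ h => by
    simp only [hhatP t a ω ω₂ h]
  have hGP : ∀ t a, IsPast AB t (fun ω => pol t a ω / (hatπ t a ω + ε t)) := fun t a ω ω₂ h => by
    simp only [hhatP t a ω ω₂ h, hpolP t a ω ω₂ h]
  -- the estimated-gain terms
  have hXI : ∀ t a, Integrable (fun ω => pol t a ω *
      (r t a * (if AB t ω = a then 1 else 0) / (hatπ t a ω + ε t))) μ := fun t a => by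
    refine past_integrable μ AB hAB_meas (t := t + 1) fun ω ω₂ h => ?_
    simp only [hhatP t a ω ω₂ (fun k hk => h k (by omega)),
      hpolP t a ω ω₂ (fun k hk => h k (by omega)), h t (by omega)]
  have hrtE : ∀ t a, ∫ ω, rtil t a ω ∂μ = r t a * (πB a * ∫ ω, 1 / (hatπ t a ω + γ t) ∂μ) := by
    intro t a
    rw [← past_mul_integral μ AB hAB_meas hAB_indep πB hπB_pos hAB_law (hFP t a) a,
      ← integral_const_mul]
    congr 1
    funext ω
    rw [hrtil]
    ring
  have hXE : ∀ t a, ∫ ω, pol t a ω *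
      (r t a * (if AB t ω = a then 1 else 0) / (hatπ t a ω + ε t)) ∂μ
      = r t a * (πB a * ∫ ω, pol t a ω / (hatπ t a ω + ε t) ∂μ) := by
    intro t a
    rw [← past_mul_integral μ AB hAB_meas hAB_indep πB hπB_pos hAB_law (hGP t a) a,
      ← integral_const_mul]
    congr 1
    funext ω
    ring
  -- deterministic regret bound, integrated
  have hmain : ∑ t ∈ Finset.range (m + 1), ∑ a, πstar a * ∫ ω, rtil t a ω ∂μ ≤
      Real.log K / η + ∑ t ∈ Finset.range (m + 1), ∑ a, ∫ ω, pol t a ω *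
      (r t a * (if AB t ω = a then 1 else 0) / (hatπ t a ω + ε t)) ∂μ := by
    have hdet : ∀ ω, ∑ t ∈ Finset.range (m + 1), ∑ a, πstar a * rtil t a ω ≤
        Real.log K / η + ∑ t ∈ Finset.range (m + 1), ∑ a, pol t a ω *
        (r t a * (if AB t ω = a then 1 else 0) / (hatπ t a ω + ε t)) := by
      intro ω
      rw [hK]
      refine ew_regret η hη0 (fun t a => r t a * (if AB t ω = a then 1 else 0))
        (fun t a => hatπ t a ω + ε t) (fun t a => rtil t a ω) (fun t a => w t a ω)
        (fun t a => pol t a ω) ?_ ?_ ?_ ?_ ?_ ?_ πstar hπstar_nonneg hπstar_sum (m + 1)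
      · intro t a
        have := (hr t a).1
        split_ifs <;> linarith
      · intro t a
        have := (hr t a).2
        split_ifs <;> linarith
      · intro t a
        have := hhat0 t a ω
        have := hεpos t
        linarith
      · intro t a
        rw [hrtil, hεdef, add_assoc]
      · intro t a; exact hw t a ω
      · intro t a; exact hpol t a ω
    have hLI : Integrable (fun ω => ∑ t ∈ Finset.range (m + 1), ∑ a, πstar a * rtil t a ω) μ :=
      integrable_finsetSum _ fun t _ => integrable_finsetSum _ fun a _ => (hrtI t a).const_mul _
    have hUI : Integrable (fun ω => ∑ t ∈ Finset.range (m + 1), ∑ a, pol t a ω *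
        (r t a * (if AB t ω = a then 1 else 0) / (hatπ t a ω + ε t))) μ :=
      integrable_finsetSum _ fun t _ => integrable_finsetSum _ fun a _ => hXI t a
    have h := integral_mono hLI ((integrable_const (Real.log K / η)).add hUI) hdet
    simp only [Pi.add_apply] at h
    rw [integral_add (integrable_const _) hUI, integral_finsetSum _ (fun t _ =>
      integrable_finsetSum _ fun a _ => (hrtI t a).const_mul _), integral_finsetSum _ (fun t _ =>
      integrable_finsetSum _ fun a _ => hXI t a)] at h
    simp only [integral_const, probReal_univ, one_smul] at h
    have e1 : ∀ t, ∫ ω, ∑ a, πstar a * rtil t a ω ∂μ = ∑ a, πstar a * ∫ ω, rtil t a ω ∂μ := by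
      intro t
      rw [integral_finsetSum _ (fun a _ => (hrtI t a).const_mul _)]
      simp only [integral_const_mul]
    have e2 : ∀ t, ∫ ω, ∑ a, pol t a ω *
        (r t a * (if AB t ω = a then 1 else 0) / (hatπ t a ω + ε t)) ∂μ = ∑ a, ∫ ω, pol t a ω *
        (r t a * (if AB t ω = a then 1 else 0) / (hatπ t a ω + ε t)) ∂μ := by
      intro t
      rw [integral_finsetSum _ (fun a _ => hXI t a)]
    simp only [e1, e2] at h
    exact h
  set C := ∑ a, πstar a / πB a with hC
  have hC0 : 0 ≤ C := Finset.sum_nonneg fun a _ => div_nonneg (hπstar_nonneg a) (hπB_pos a).le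
  -- lower bounds
  have hlow0 : ∑ a, πstar a * r 0 a - 1 ≤ ∑ a, πstar a * ∫ ω, rtil 0 a ω ∂μ := by
    have h1 : 0 ≤ ∑ a, πstar a * ∫ ω, rtil 0 a ω ∂μ := by
      refine Finset.sum_nonneg fun a _ => mul_nonneg (hπstar_nonneg a) (integral_nonneg fun ω => ?_)
      show 0 ≤ rtil 0 a ω
      rw [hrtil]
      have := hhat0 0 a ω
      have := hγpos 0
      have := (hr 0 a).1
      split_ifs <;> simp; positivity
    have h2 : ∑ a, πstar a * r 0 a ≤ 1 := by
      rw [← hπstar_sum]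
      exact Finset.sum_le_sum fun a _ => mul_le_of_le_one_right (hπstar_nonneg a) (hr 0 a).2
    linarith
  have hhatE : ∀ t a, ∫ ω, hatπ (t + 1) a ω ∂μ = πB a := by
    intro t a
    have hindI : ∀ i, Integrable (fun ω => if AB i ω = a then (1:ℝ) else 0) μ := fun i => by
      refine past_integrable μ AB hAB_meas (t := i + 1) fun ω ω₂ h => ?_
      simp [h i (by omega)]
    simp only [hhatπ]
    rw [integral_div, integral_finsetSum _ (fun k _ => hindI k)]
    simp only [ind_integral μ AB hAB_meas πB hπB_pos hAB_law]
    simp only [Finset.sum_const, Finset.card_range, nsmul_eq_mul]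
    have : ((t + 1 : ℕ) : ℝ) ≠ 0 := by positivity
    field_simp
  have hlow : ∀ t, ∑ a, πstar a * r (t + 1) a - γ (t + 1) * C ≤
      ∑ a, πstar a * ∫ ω, rtil (t + 1) a ω ∂μ := by
    intro t
    rw [hC, Finset.mul_sum, ← Finset.sum_sub_distrib]
    refine Finset.sum_le_sum fun a _ => ?_
    have hp := hπB_pos a
    have hg := hγpos (t + 1)
    have h1 : 1 - γ (t + 1) / πB a ≤ πB a * ∫ ω, 1 / (hatπ (t + 1) a ω + γ (t + 1)) ∂μ := by
      have hI1 : Integrable (fun ω => πB a / (πB a + γ (t + 1)) ^ 2 * (hatπ (t + 1) a ω - πB a)) μ :=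
        ((hhatI (t + 1) a).sub (integrable_const _)).const_mul _
      have h := integral_mono (μ := μ) ((integrable_const (1 - γ (t + 1) / πB a)).sub hI1)
        ((past_integrable μ AB hAB_meas (hFP (t + 1) a)).const_mul (πB a))
        (fun ω => tangent (hhat0 (t + 1) a ω) hp hg)
      simp only [Pi.sub_apply] at h
      rw [integral_sub (integrable_const _) hI1, integral_const_mul, integral_const_mul,
        integral_sub (hhatI _ a) (integrable_const _), hhatE] at h
      simpa using h
    rw [hrtE]
    have hr0 := (hr (t + 1) a).1
    have hr1 := (hr (t + 1) a).2
    have hgp : 0 ≤ γ (t + 1) / πB a := by positivity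
    have h2 : r (t + 1) a - γ (t + 1) / πB a ≤
        r (t + 1) a * (πB a * ∫ ω, 1 / (hatπ (t + 1) a ω + γ (t + 1)) ∂μ) := by
      have := mul_le_mul_of_nonneg_left h1 hr0
      nlinarith
    have h3 := mul_le_mul_of_nonneg_left h2 (hπstar_nonneg a)
    calc _ = πstar a * (r (t + 1) a - γ (t + 1) / πB a) := by ring
      _ ≤ _ := h3
  -- upper bounds
  have hup0 : ∑ a, ∫ ω, pol 0 a ω *
      (r 0 a * (if AB 0 ω = a then 1 else 0) / (hatπ 0 a ω + ε 0)) ∂μ ≤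
      ∑ a, (∫ ω, pol 0 a ω ∂μ) * r 0 a := by
    refine Finset.sum_le_sum fun a _ => ?_
    rw [hXE, mul_comm]
    refine mul_le_mul_of_nonneg_right ?_ (hr 0 a).1
    rw [hε0]
    have : ∀ ω, hatπ 0 a ω = 0 := fun ω => by rw [hhatπ]; simp
    simp only [this, zero_add, div_one]
    exact mul_le_of_le_one_left (integral_nonneg fun ω => hpol0 0 a ω) (hpB1 a)
  have hup : ∀ t < m, ∑ a, ∫ ω, pol (t + 1) a ω *
      (r (t + 1) a * (if AB (t + 1) ω = a then 1 else 0) / (hatπ (t + 1) a ω + ε (t + 1))) ∂μ ≤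
      ∑ a, (∫ ω, pol (t + 1) a ω ∂μ) * r (t + 1) a + 1 / η * (1 / ((t:ℝ) + 1) ^ 2) := by
    intro t htm
    have he := hεpos (t + 1)
    have hlogt := hlogKt (t + 1) (by omega)
    have hlogt0 := (hlogK.trans_le hlogt).le
    have hprob : ∀ a, μ.real {ω | hatπ (t + 1) a ω + ε (t + 1) ≤ πB a} ≤
        1 / (K * ((t:ℝ) + 1) ^ 2) := by
      intro a
      have h := hoeff μ AB hAB_meas hAB_indep πB hπB_pos hAB_law (t + 1) (by omega) a
        (ε (t + 1)) he.le
      simp only [hhatπ]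
      refine h.trans (le_of_eq ?_)
      rw [hε (t + 1) (by omega), Real.sq_sqrt (by positivity)]
      have : (2 * ((t + 1 : ℕ) : ℝ) * (Real.log (K * ((t + 1 : ℕ) : ℝ) ^ 2) / (2 * ((t + 1 : ℕ) : ℝ))))
          = Real.log (K * ((t + 1 : ℕ) : ℝ) ^ 2) := by
        have : ((t + 1 : ℕ) : ℝ) ≠ 0 := by positivity
        field_simp
      rw [this, Real.exp_neg, Real.exp_log (by positivity)]
      push_cast
      rw [one_div]
    have hηε : η ≤ 2 * ε (t + 1) := by
      rw [hη, hε (t + 1) (by omega)]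
      have : (2:ℝ) = Real.sqrt 4 := by
        rw [show (4:ℝ) = 2 ^ 2 by norm_num, Real.sqrt_sq (by norm_num)]
      conv_rhs => rw [this]
      rw [← Real.sqrt_mul (by norm_num)]
      refine Real.sqrt_le_sqrt ?_
      have h1 : (((t + 1 : ℕ)) : ℝ) ≤ ((m + 1 : ℕ) : ℝ) := by exact_mod_cast (by omega)
      have h0 : (0:ℝ) < ((t + 1 : ℕ) : ℝ) := by positivity
      calc Real.log K / ((m + 1 : ℕ) : ℝ) ≤ Real.log K / ((t + 1 : ℕ) : ℝ) := by gcongr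
        _ ≤ Real.log (K * ((t + 1 : ℕ) : ℝ) ^ 2) / ((t + 1 : ℕ) : ℝ) := by gcongr
        _ ≤ 2 * (Real.log (K * ((t + 1 : ℕ) : ℝ) ^ 2) / ((t + 1 : ℕ) : ℝ)) := by
          have : 0 ≤ Real.log (K * ((t + 1 : ℕ) : ℝ) ^ 2) / ((t + 1 : ℕ) : ℝ) := by positivity
          linarith
        _ = _ := by field_simp; ring
    have hδ : 1 / ε (t + 1) * (1 / (K * ((t:ℝ) + 1) ^ 2)) ≤ 1 / η * (1 / ((t:ℝ) + 1) ^ 2) := by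
      have : 1 / ε (t + 1) * (1 / (K * ((t:ℝ) + 1) ^ 2)) =
          1 / (K * ε (t + 1)) * (1 / ((t:ℝ) + 1) ^ 2) := by
        field_simp
      rw [this]
      have : η ≤ K * ε (t + 1) := by nlinarith
      gcongr
    have hterm : ∀ a, ∫ ω, pol (t + 1) a ω *
        (r (t + 1) a * (if AB (t + 1) ω = a then 1 else 0) / (hatπ (t + 1) a ω + ε (t + 1))) ∂μ ≤
        (∫ ω, pol (t + 1) a ω ∂μ) * r (t + 1) a + πB a * (1 / η * (1 / ((t:ℝ) + 1) ^ 2)) := by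
      intro a
      have hp := hπB_pos a
      have hms : MeasurableSet {ω | hatπ (t + 1) a ω + ε (t + 1) ≤ πB a} := by
        have hmm : Measurable (hatπ (t + 1) a) := by
          have : hatπ (t + 1) a = fun ω => (∑ k ∈ Finset.range (t + 1),
              (fun x => if x = a then (1 : ℝ) else 0) (AB k ω)) / ((t + 1 : ℕ) : ℝ) := by
            funext ω; exact hhatπ _ _ _
          rw [this]
          refine Measurable.div_const (Finset.measurable_fun_sum _ fun k _ => ?_) _
          exact (measurable_of_finite (fun x : 𝒜 => if x = a then (1 : ℝ) else 0)).comp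
            (hAB_meas k)
        exact measurableSet_le (hmm.add_const _) measurable_const
      have hIi : Integrable (Set.indicator {ω | hatπ (t + 1) a ω + ε (t + 1) ≤ πB a}
          (1 : Ω → ℝ)) μ := (integrable_const (1:ℝ)).indicator hms
      have hpt : ∀ ω, πB a * (pol (t + 1) a ω / (hatπ (t + 1) a ω + ε (t + 1))) ≤
          pol (t + 1) a ω + πB a * (1 / ε (t + 1)) *
          Set.indicator {ω | hatπ (t + 1) a ω + ε (t + 1) ≤ πB a} (1 : Ω → ℝ) ω := by
        intro ω
        have hh := hhat0 (t + 1) a ω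
        have hq : 0 < hatπ (t + 1) a ω + ε (t + 1) := by linarith
        have hq0 := hpol0 (t + 1) a ω
        have hq1 := hpol1 (t + 1) a ω
        by_cases hb : hatπ (t + 1) a ω + ε (t + 1) ≤ πB a
        · rw [Set.indicator_of_mem (by exact hb)]
          have : pol (t + 1) a ω / (hatπ (t + 1) a ω + ε (t + 1)) ≤ 1 / ε (t + 1) := by
            gcongr
            linarith
          have := mul_le_mul_of_nonneg_left this hp.le
          simp only [Pi.one_apply, mul_one]
          linarith
        · rw [Set.indicator_of_notMem (by exact hb)]
          rw [mul_zero, add_zero, mul_div_assoc', div_le_iff₀ hq]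
          push Not at hb
          nlinarith
      have h := integral_mono (μ := μ)
        ((past_integrable μ AB hAB_meas (hGP (t + 1) a)).const_mul (πB a))
        ((hpolI (t + 1) a).add (hIi.const_mul (πB a * (1 / ε (t + 1))))) hpt
      simp only [Pi.add_apply] at h
      rw [integral_const_mul, integral_add (hpolI _ a) (hIi.const_mul _), integral_const_mul,
        integral_indicator_one hms] at h
      have h2 : πB a * (1 / ε (t + 1)) * μ.real {ω | hatπ (t + 1) a ω + ε (t + 1) ≤ πB a} ≤
          πB a * (1 / η * (1 / ((t:ℝ) + 1) ^ 2)) := by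
        rw [mul_assoc]
        refine mul_le_mul_of_nonneg_left (le_trans ?_ hδ) hp.le
        exact mul_le_mul_of_nonneg_left (hprob a) (by positivity)
      rw [hXE]
      have hr0 := (hr (t + 1) a).1
      have hr1 := (hr (t + 1) a).2
      have hnn : 0 ≤ πB a * (1 / η * (1 / ((t:ℝ) + 1) ^ 2)) := by positivity
      have h3 := mul_le_mul_of_nonneg_left (h.trans (add_le_add_right h2 _)) hr0
      refine h3.trans ?_
      nlinarith
    refine (Finset.sum_le_sum fun a _ => hterm a).trans (le_of_eq ?_)
    rw [Finset.sum_add_distrib, ← Finset.sum_mul, hπB_sum, one_mul]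
  -- summing the exploration parameters
  have hγsum : ∑ t ∈ Finset.range m, γ (t + 1) ≤ η * ((m + 1 : ℕ) : ℝ) / 2 +
      2 * Real.sqrt (((m + 1 : ℕ) : ℝ) * Real.log (K * ((m + 1 : ℕ) : ℝ))) := by
    have hL0 : 0 ≤ Real.log (K * ((m + 1 : ℕ) : ℝ)) := by
      refine Real.log_nonneg ?_
      have : (1:ℝ) ≤ ((m + 1 : ℕ) : ℝ) := by push_cast; linarith [Nat.cast_nonneg (α := ℝ) m]
      nlinarith
    have h1 : ∀ t ∈ Finset.range m, γ (t + 1) ≤ η / 2 +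
        Real.sqrt (Real.log (K * ((m + 1 : ℕ) : ℝ))) * (1 / Real.sqrt ((t:ℝ) + 1)) := by
      intro t ht
      have htm := Finset.mem_range.mp ht
      rw [hγ (t + 1) (by omega), mul_one_div, ← Real.sqrt_div hL0]
      have h1 : (((t + 1 : ℕ)) : ℝ) ≤ ((m + 1 : ℕ) : ℝ) := by exact_mod_cast (by omega)
      have h0 : (0:ℝ) < ((t + 1 : ℕ) : ℝ) := by positivity
      have h2 : Real.log (K * ((t + 1 : ℕ) : ℝ) ^ 2) ≤ 2 * Real.log (K * ((m + 1 : ℕ) : ℝ)) := by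
        have : 2 * Real.log (K * ((m + 1 : ℕ) : ℝ)) = Real.log ((K * ((m + 1 : ℕ) : ℝ)) ^ 2) := by
          rw [Real.log_pow]; norm_num
        rw [this]
        refine Real.log_le_log (by positivity) ?_
        rw [mul_pow]
        gcongr
        nlinarith
      have h3 : Real.log (K * ((t + 1 : ℕ) : ℝ) ^ 2) / (2 * ((t + 1 : ℕ) : ℝ)) ≤
          Real.log (K * ((m + 1 : ℕ) : ℝ)) / ((t:ℝ) + 1) := by
        calc _ ≤ 2 * Real.log (K * ((m + 1 : ℕ) : ℝ)) / (2 * ((t + 1 : ℕ) : ℝ)) := by gcongr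
          _ = _ := by push_cast; field_simp
      have := Real.sqrt_le_sqrt h3
      linarith
    refine (Finset.sum_le_sum h1).trans ?_
    rw [Finset.sum_add_distrib, ← Finset.mul_sum]
    simp only [Finset.sum_const, Finset.card_range, nsmul_eq_mul]
    have h2 := mul_le_mul_of_nonneg_left (sum_inv_sqrt m)
      (Real.sqrt_nonneg (Real.log (K * ((m + 1 : ℕ) : ℝ))))
    have h3 : Real.sqrt m ≤ Real.sqrt ((m + 1 : ℕ) : ℝ) :=
      Real.sqrt_le_sqrt (by push_cast; linarith)
    have h4 := mul_le_mul_of_nonneg_left h3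
      (Real.sqrt_nonneg (Real.log (K * ((m + 1 : ℕ) : ℝ))))
    rw [Real.sqrt_mul (by positivity)]
    have h5 : (m:ℝ) * (η / 2) ≤ η * ((m + 1 : ℕ) : ℝ) / 2 := by push_cast; linarith
    nlinarith
  -- conclusion
  have hfin : ∑ t ∈ Finset.range (m + 1), ∑ a, (πstar a - ∫ ω, pol t a ω ∂μ) * r t a =
      ∑ t ∈ Finset.range (m + 1), ∑ a, πstar a * r t a -
      ∑ t ∈ Finset.range (m + 1), ∑ a, (∫ ω, pol t a ω ∂μ) * r t a := by
    simp only [sub_mul, Finset.sum_sub_distrib]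
  rw [hfin]
  simp only [Finset.sum_range_succ' _ m] at hmain ⊢
  have hA := Finset.sum_le_sum fun t (_ : t ∈ Finset.range m) => hlow t
  have hB := Finset.sum_le_sum fun t (ht : t ∈ Finset.range m) => hup t (Finset.mem_range.mp ht)
  rw [Finset.sum_sub_distrib, ← Finset.sum_mul] at hA
  rw [Finset.sum_add_distrib, ← Finset.mul_sum] at hB
  have hS := mul_le_mul_of_nonneg_left (sum_inv_sq m) (show 0 ≤ 1 / η by positivity)
  have hG := mul_le_mul_of_nonneg_right hγsum hC0
  have hη1 : 0 < 1 / η := by positivity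
  have hsplit : (16 + Real.log K) / η = 16 * (1 / η) + Real.log K / η := by ring
  rw [hsplit]
  linarith
end

section
/- Let η > 0 be a learning rate satisfying λ_min(V̄(π_B)) ≥ 2η·sup_{x,a} ‖φ(x,a)‖₂². Then for any comparator policy π* the expected regret of LinProd is bounded as E[R(π*)] ≤ (log K)/η + η·n·C_φ(π*;π_B), where C_φ(π*;π_B) = Tr(V̄(π_B)^{-1}·V̄(π*)) is the feature coverage ratio. -/
open MeasureTheory ProbabilityTheory Matrix

lemma lp_log_ineq (z : ℝ) (hz : |z| ≤ 1/2) : z - z^2 ≤ Real.log (1+z) := by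
  obtain ⟨h1, h2⟩ := abs_le.1 hz
  have hp : 0 < 1 + z := by linarith
  rcases le_total 0 z with h | h
  · have := Real.one_sub_inv_le_log_of_pos hp
    refine le_trans ?_ this
    have : 1 - (1+z)⁻¹ = z / (1+z) := by field_simp; ring
    rw [this, le_div_iff₀ hp]
    nlinarith [pow_nonneg h 3]
  · rw [Real.le_log_iff_exp_le hp]
    obtain ⟨x, rfl⟩ : ∃ x, z = -x := ⟨-z, by ring⟩
    have hx0 : 0 ≤ x := by linarith
    have hx : x ≤ 1/2 := by linarith
    have h3 := Real.quadratic_le_exp_of_nonneg (x := x + x^2) (by positivity)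
    have h4 : -x - (-x)^2 = -(x+x^2) := by ring
    rw [h4, Real.exp_neg]
    rw [inv_le_comm₀ (Real.exp_pos _) hp]
    refine le_trans ?_ h3
    rw [inv_le_iff_one_le_mul₀ hp]
    have e : (1 + (x + x^2) + (x+x^2)^2/2) * (1 + -x) = 1 + x^2/2*(1-x-x^2-x^3) := by ring
    rw [e]
    have : x^2 ≤ 1/4 := by nlinarith
    have : x^3 ≤ 1/8 := by nlinarith
    have : 0 ≤ x^2/2*(1-x-x^2-x^3) := mul_nonneg (by positivity) (by linarith)
    linarith

lemma lp_w_pos {𝒜 : Type*} (η : ℝ) (y : ℕ → 𝒜 → ℝ) (hy : ∀ t a, |η * y t a| ≤ 1/2)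
    (t : ℕ) (a : 𝒜) : 0 < ∏ k ∈ Finset.range t, (1 + η * y k a) :=
  Finset.prod_pos fun k _ => by have := (abs_le.1 (hy k a)).1; linarith

lemma lp_potential {𝒜 : Type*} [Fintype 𝒜] [Nonempty 𝒜] (η : ℝ) (hη : 0 < η) (n : ℕ)
    (y : ℕ → 𝒜 → ℝ) (hy : ∀ t a, |η * y t a| ≤ 1/2)
    (p : 𝒜 → ℝ) (hp : ∀ a, 0 ≤ p a) (hps : ∑ a, p a = 1)
    (w : ℕ → 𝒜 → ℝ) (hw : ∀ t a, w t a = ∏ k ∈ Finset.range t, (1 + η * y k a))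
    (pol : ℕ → 𝒜 → ℝ) (hpol : ∀ t a, pol t a = w t a / ∑ a', w t a') :
    ∑ t ∈ Finset.range n, ∑ a, (p a - pol t a) * y t a ≤
      Real.log (Fintype.card 𝒜) / η + η * ∑ t ∈ Finset.range n, ∑ a, p a * y t a ^ 2 := by
  have hwp : ∀ t a, 0 < w t a := fun t a => by rw [hw]; exact lp_w_pos η y hy t a
  have hWp : ∀ t, 0 < ∑ a, w t a := fun t =>
    Finset.sum_pos (fun a _ => hwp t a) Finset.univ_nonempty
  have hstep : ∀ t, ∑ a, w (t+1) a = (∑ a, w t a) * (1 + η * ∑ a, pol t a * y t a) := by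
    intro t
    have h1 : ∀ a, w (t+1) a = w t a + η * (w t a * y t a) := by
      intro a; rw [hw, hw, Finset.prod_range_succ]; ring
    have h2 : (∑ a, w t a) * ∑ a, pol t a * y t a = ∑ a, w t a * y t a := by
      rw [Finset.mul_sum]
      refine Finset.sum_congr rfl fun a _ => ?_
      rw [hpol]; have := (hWp t).ne'; field_simp
    rw [Finset.sum_congr rfl fun a _ => h1 a, Finset.sum_add_distrib, ← Finset.mul_sum, ← h2]
    ring
  have hup : ∀ m, Real.log (∑ a, w m a) ≤ Real.log (Fintype.card 𝒜) +
      η * ∑ t ∈ Finset.range m, ∑ a, pol t a * y t a := by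
    intro m
    induction m with
    | zero => simp [hw]
    | succ m ih =>
      have hpos : 0 < 1 + η * ∑ a, pol m a * y m a := by
        have := hWp (m+1); rw [hstep] at this
        exact (pos_iff_pos_of_mul_pos this).1 (hWp m)
      rw [hstep, Real.log_mul (hWp m).ne' hpos.ne', Finset.sum_range_succ, mul_add]
      have := Real.log_le_sub_one_of_pos hpos
      linarith
  have hlow : ∑ a, p a * ∑ t ∈ Finset.range n, (η * y t a - (η * y t a)^2) ≤
      Real.log (∑ a, w n a) := by
    calc _ ≤ ∑ a, p a * Real.log (∑ a, w n a) := by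
          refine Finset.sum_le_sum fun a _ => mul_le_mul_of_nonneg_left ?_ (hp a)
          calc _ ≤ Real.log (w n a) := by
                rw [hw, Real.log_prod (fun k _ => ?_)]
                · exact Finset.sum_le_sum fun t _ => lp_log_ineq _ (hy t a)
                · have := (abs_le.1 (hy k a)).1
                  intro h; linarith
            _ ≤ _ := Real.log_le_log (hwp n a)
              (Finset.single_le_sum (fun a _ => (hwp n a).le) (Finset.mem_univ a))
      _ = _ := by rw [← Finset.sum_mul, hps, one_mul]
  have hE : ∑ a, p a * ∑ t ∈ Finset.range n, (η * y t a - (η * y t a)^2) =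
      η * (∑ t ∈ Finset.range n, ∑ a, p a * y t a)
        - η^2 * ∑ t ∈ Finset.range n, ∑ a, p a * y t a ^ 2 := by
    simp only [Finset.mul_sum]
    rw [Finset.sum_comm, ← Finset.sum_sub_distrib]
    refine Finset.sum_congr rfl fun t _ => ?_
    rw [← Finset.sum_sub_distrib]
    refine Finset.sum_congr rfl fun a _ => ?_
    ring
  have h3 := hup n
  rw [hE] at hlow
  simp only [sub_mul, Finset.sum_sub_distrib]
  have h4 : η * (∑ t ∈ Finset.range n, ∑ a, p a * y t a
      - ∑ t ∈ Finset.range n, ∑ a, pol t a * y t a) ≤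
      η * (Real.log (Fintype.card 𝒜) / η + η * ∑ t ∈ Finset.range n, ∑ a, p a * y t a ^ 2) := by
    rw [mul_add, mul_div_cancel₀ _ hη.ne']
    nlinarith
  exact le_of_mul_le_mul_left h4 hη

lemma lp_quad {d : ℕ} (V : Matrix (Fin d) (Fin d) ℝ) (hV : V.IsHermitian) (c : ℝ)
    (hc : ∀ i, c ≤ hV.eigenvalues i) (q : Fin d → ℝ) :
    c * (q ⬝ᵥ q) ≤ q ⬝ᵥ (V *ᵥ q) := by
  have h1 : (V - c • (1 : Matrix (Fin d) (Fin d) ℝ)).PosSemidef := by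
    set U : Matrix (Fin d) (Fin d) ℝ := (hV.eigenvectorUnitary : Matrix (Fin d) (Fin d) ℝ) with hU
    have hs := hV.spectral_theorem
    have e : V - c • (1 : Matrix (Fin d) (Fin d) ℝ) =
        U * (diagonal fun i => hV.eigenvalues i - c) * Uᴴ := by
      have hUU : U * Uᴴ = 1 := by
        have := Unitary.coe_mul_star_self hV.eigenvectorUnitary
        simpa [hU, star_eq_conjTranspose] using this
      have h2 : (diagonal fun i => hV.eigenvalues i - c) = diagonal hV.eigenvalues - c • (1 : Matrix (Fin d) (Fin d) ℝ) := by
        rw [smul_one_eq_diagonal, diagonal_sub]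
      rw [h2, Matrix.mul_sub, Matrix.sub_mul, Matrix.mul_smul, Matrix.smul_mul, Matrix.mul_one, hUU]
      congr 1
    rw [e]
    refine PosSemidef.mul_mul_conjTranspose_same (PosSemidef.diagonal fun i => ?_) U
    simpa using hc i
  have := h1.dotProduct_mulVec_nonneg q
  simp [sub_mulVec, smul_mulVec, dotProduct_sub] at this
  linarith

lemma lp_bound {d : ℕ} (V : Matrix (Fin d) (Fin d) ℝ) (hV : V.IsHermitian) (hdet : V.det ≠ 0)
    (η B : ℝ) (hη : 0 < η) 
    (hc : ∀ i, 2 * η * B ≤ hV.eigenvalues i) (u v : Fin d → ℝ) (hu : u ⬝ᵥ u ≤ B)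
    (hv : v ⬝ᵥ v ≤ B) : |η * (u ⬝ᵥ (V⁻¹ *ᵥ v))| ≤ 1/2 := by
  set q := V⁻¹ *ᵥ v with hq
  have hVq : V *ᵥ q = v := by
    rw [hq, mulVec_mulVec, mul_nonsing_inv _ (isUnit_iff_ne_zero.2 hdet), one_mulVec]
  have h1 := lp_quad V hV _ hc q
  rw [hVq] at h1
  have cs : ∀ a b : Fin d → ℝ, (a ⬝ᵥ b)^2 ≤ (a ⬝ᵥ a) * (b ⬝ᵥ b) := fun a b => by
    have := Finset.sum_mul_sq_le_sq_mul_sq Finset.univ a b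
    simpa [dotProduct, sq] using this
  have nn : ∀ a : Fin d → ℝ, 0 ≤ a ⬝ᵥ a := fun a =>
    Finset.sum_nonneg fun i _ => mul_self_nonneg _
  have hB : 0 ≤ B := (nn u).trans hu
  have h2 := cs q v
  have h3 := cs u q
  have hQ := nn q
  set Q := q ⬝ᵥ q
  have hs : 0 ≤ B * Q := mul_nonneg hB hQ
  have h4 : (u ⬝ᵥ q)^2 ≤ B * Q := h3.trans (mul_le_mul_of_nonneg_right hu hQ)
  have h5 : (2 * η * B * Q)^2 ≤ B * Q := by
    calc _ ≤ (q ⬝ᵥ v)^2 := by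
            have : 0 ≤ 2 * η * B * Q := by positivity
            exact pow_le_pow_left₀ this h1 2
      _ ≤ Q * (v ⬝ᵥ v) := h2
      _ ≤ B * Q := by rw [mul_comm]; exact mul_le_mul_of_nonneg_right hv hQ
  have h6 : η^2 * (B * Q) ≤ 1/4 := by
    rcases hs.eq_or_lt with h | h
    · rw [← h]; norm_num
    · have : (4 * (η^2 * (B*Q))) * (B * Q) ≤ 1 * (B * Q) := by nlinarith
      have := le_of_mul_le_mul_right this h
      linarith
  apply abs_le_of_sq_le_sq _ (by norm_num)
  nlinarith [sq_nonneg η]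

lemma lp_law {Ω 𝒳 𝒜 : Type*} [MeasurableSpace Ω] (μ : Measure Ω) [IsProbabilityMeasure μ]
    [MeasurableSpace 𝒳] (ν : Measure 𝒳) [IsProbabilityMeasure ν]
    [Fintype 𝒜] [DecidableEq 𝒜] [MeasurableSpace 𝒜] [MeasurableSingletonClass 𝒜]
    (πB : 𝒳 → 𝒜 → ℝ) (hπB_nonneg : ∀ x a, 0 ≤ πB x a)
    (hπB_meas : ∀ a, Measurable fun x => πB x a)
    (X : Ω → 𝒳) (AB : Ω → 𝒜) (hX : Measurable X) (hA : Measurable AB)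
    (h_law : ∀ (S : Set 𝒳), MeasurableSet S → ∀ a,
      μ {ω | X ω ∈ S ∧ AB ω = a} = ∫⁻ x in S, ENNReal.ofReal (πB x a) ∂ν)
    (f : 𝒳 → 𝒜 → ℝ) (hf : ∀ a, Measurable fun x => f x a) (C : ℝ) (hC : ∀ x a, |f x a| ≤ C)
    (hint : ∀ a, Integrable (fun x => πB x a * f x a) ν) :
    ∫ ω, f (X ω) (AB ω) ∂μ = ∫ x, ∑ a, πB x a * f x a ∂ν := by
  have hm : ∀ a, MeasurableSet {ω | AB ω = a} := fun a => hA (measurableSet_singleton a)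
  have e : ∀ ω, f (X ω) (AB ω) = ∑ a, Set.indicator {ω | AB ω = a} (fun ω => f (X ω) a) ω := by
    intro ω
    rw [Finset.sum_eq_single (AB ω)]
    · simp
    · intro b _ hb; simp [hb.symm]
    · simp
  have hi : ∀ a, Integrable (fun ω => f (X ω) a) μ := fun a =>
    Integrable.of_bound ((hf a).comp hX).aestronglyMeasurable C
      (Filter.Eventually.of_forall fun ω => by simpa using hC _ _)
  simp_rw [e]
  rw [integral_finsetSum _ (fun a _ => (hi a).indicator (hm a)), integral_finsetSum _ (fun a _ => hint a)]
  refine Finset.sum_congr rfl fun a _ => ?_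
  rw [integral_indicator (hm a)]
  have hmap : (μ.restrict {ω | AB ω = a}).map X = ν.withDensity fun x => ENNReal.ofReal (πB x a) := by
    ext S hS
    rw [Measure.map_apply hX hS, withDensity_apply _ hS, ← h_law S hS a,
      Measure.restrict_apply (hX hS)]
    rfl
  rw [← integral_map (μ := μ.restrict {ω | AB ω = a}) (f := fun x => f x a) hX.aemeasurable (hf a).aestronglyMeasurable, hmap,
    integral_withDensity_eq_integral_toReal_smul (hπB_meas a).ennreal_ofReal (by simp)]
  refine integral_congr_ae (Filter.Eventually.of_forall fun x => ?_)
  simp [ENNReal.toReal_ofReal (hπB_nonneg x a)]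

lemma lp_decouple {Ω 𝒳 E : Type*} [MeasurableSpace Ω] (μ : Measure Ω) [IsProbabilityMeasure μ]
    [MeasurableSpace 𝒳] (ν : Measure 𝒳) [IsProbabilityMeasure ν] [MeasurableSpace E]
    (H : Ω → E) (X : Ω → 𝒳) (hH : Measurable H) (hX : Measurable X) (hind : IndepFun H X μ)
    (hlaw : μ.map X = ν) (g : E × 𝒳 → ℝ) (hg : Measurable g) (C : ℝ) (hC : ∀ e, |g e| ≤ C) :
    ∫ ω, g (H ω, X ω) ∂μ = ∫ x, ∫ ω, g (H ω, x) ∂μ ∂ν ∧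
    Integrable (fun x => ∫ ω, g (H ω, x) ∂μ) ν := by
  have hp := (indepFun_iff_map_prod_eq_prod_map_map hH.aemeasurable hX.aemeasurable).1 hind
  rw [hlaw] at hp
  have : IsProbabilityMeasure (μ.map H) := Measure.isProbabilityMeasure_map hH.aemeasurable
  have hi : Integrable g ((μ.map H).prod ν) :=
    Integrable.of_bound hg.aestronglyMeasurable C (Filter.Eventually.of_forall fun e => by simpa using hC e)
  have h2 : ∀ x, ∫ ω, g (H ω, x) ∂μ = ∫ h, g (h, x) ∂(μ.map H) := fun x => by
    rw [integral_map hH.aemeasurable]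
    exact (hg.comp (measurable_id.prodMk measurable_const)).aestronglyMeasurable
  simp_rw [h2]
  refine ⟨?_, hi.integral_prod_right⟩
  rw [← integral_prod_symm g hi, ← hp, integral_map (hH.prodMk hX).aemeasurable hg.aestronglyMeasurable]

lemma lp_mapX {Ω 𝒳 𝒜 : Type*} [MeasurableSpace Ω] (μ : Measure Ω)
    [MeasurableSpace 𝒳] (ν : Measure 𝒳)
    [Fintype 𝒜] [MeasurableSpace 𝒜] [MeasurableSingletonClass 𝒜]
    (πB : 𝒳 → 𝒜 → ℝ) (hπB_nonneg : ∀ x a, 0 ≤ πB x a) (hπB_sum : ∀ x, ∑ a, πB x a = 1)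
    (hπB_meas : ∀ a, Measurable fun x => πB x a)
    (X : Ω → 𝒳) (AB : Ω → 𝒜) (hX : Measurable X) (hA : Measurable AB)
    (h_law : ∀ (S : Set 𝒳), MeasurableSet S → ∀ a,
      μ {ω | X ω ∈ S ∧ AB ω = a} = ∫⁻ x in S, ENNReal.ofReal (πB x a) ∂ν) :
    μ.map X = ν := by
  ext S hS
  rw [Measure.map_apply hX hS]
  have e : X ⁻¹' S = ⋃ a, {ω | X ω ∈ S ∧ AB ω = a} := by ext ω; simp
  rw [e, measure_iUnion, tsum_fintype, Finset.sum_congr rfl fun a _ => h_law S hS a,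
    ← lintegral_finsetSum _ (fun a _ => (hπB_meas a).ennreal_ofReal)]
  · have : ∀ x, ∑ a, ENNReal.ofReal (πB x a) = 1 := fun x => by
      rw [← ENNReal.ofReal_sum_of_nonneg (fun a _ => hπB_nonneg x a), hπB_sum]; simp
    simp [this]
  · intro a b hab
    refine Set.disjoint_left.2 fun ω h1 h2 => hab (h1.2.symm.trans h2.2)
  · intro a
    exact (hX hS).inter (hA (measurableSet_singleton a))

lemma lp_moment {𝒳 𝒜 : Type*} [MeasurableSpace 𝒳] (ν : Measure 𝒳)
    [Fintype 𝒜] {d : ℕ} (φ : 𝒳 → 𝒜 → (Fin d → ℝ))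
    (π : 𝒳 → 𝒜 → ℝ) (V : Matrix (Fin d) (Fin d) ℝ)
    (hV : ∀ i j, V i j = ∫ x, ∑ a, π x a * (φ x a i * φ x a j) ∂ν)
    (hint : ∀ a i j, Integrable (fun x => π x a * (φ x a i * φ x a j)) ν)
    (M : Matrix (Fin d) (Fin d) ℝ) :
    ∫ x, ∑ a, π x a * (φ x a ⬝ᵥ (M *ᵥ φ x a)) ∂ν = Matrix.trace (M * V) := by
  have e : ∀ x, ∑ a, π x a * (φ x a ⬝ᵥ (M *ᵥ φ x a)) =
      ∑ i, ∑ j, M i j * ∑ a, π x a * (φ x a j * φ x a i) := by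
    intro x
    simp only [dotProduct, mulVec, Finset.mul_sum]
    rw [Finset.sum_comm]
    refine Finset.sum_congr rfl fun i _ => ?_
    rw [Finset.sum_comm]
    refine Finset.sum_congr rfl fun j _ => Finset.sum_congr rfl fun a _ => ?_
    ring
  simp_rw [e]
  have hi : ∀ i j, Integrable (fun x => M i j * ∑ a, π x a * (φ x a j * φ x a i)) ν :=
    fun i j => (integrable_finsetSum _ fun a _ => hint a j i).const_mul _
  rw [integral_finsetSum _ fun i _ => integrable_finsetSum _ fun j _ => hi i j]
  simp only [Matrix.trace, diag, Matrix.mul_apply]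
  refine Finset.sum_congr rfl fun i _ => ?_
  rw [integral_finsetSum _ fun j _ => hi i j]
  refine Finset.sum_congr rfl fun j _ => ?_
  rw [integral_const_mul, hV]

lemma lp_rank_one {d : ℕ} (p q u : Fin d → ℝ) :
    u ⬝ᵥ (vecMulVec p q *ᵥ u) = (p ⬝ᵥ u) * (u ⬝ᵥ q) := by
  rw [vecMulVec_mulVec]
  simp [dotProduct_smul, dotProduct_comm]
  ring

lemma lp_trace_rank_one {d : ℕ} (p q : Fin d → ℝ) (V : Matrix (Fin d) (Fin d) ℝ) (hV : V.IsHermitian) :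
    Matrix.trace (vecMulVec p q * V) = p ⬝ᵥ (V *ᵥ q) := by
  rw [vecMulVec_mul, trace_vecMulVec]
  have : Vᵀ = V := by rw [← conjTranspose_eq_transpose_of_trivial]; exact hV
  rw [← mulVec_transpose, this]

set_option maxHeartbeats 4000000 in


/-- Theorem 3, first bound: for adversarial linear contextual bandits
with off-policy feedback, if the learning rate `η > 0` satisfies
`λ_min(V̄(π_B)) ≥ 2η·sup_{x,a}‖φ(x,a)‖₂²`, then for any comparator policy `π*` the
expected regret of LinProd is bounded by `(log K)/η + η·n·C_φ(π*;π_B)`, where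
`C_φ(π*;π_B) = Tr(V̄(π_B)⁻¹·V̄(π*))`. -/
theorem linprod_regret_bound
    {Ω : Type*} [MeasurableSpace Ω] (μ : Measure Ω) [IsProbabilityMeasure μ]
    {𝒳 : Type*} [MeasurableSpace 𝒳] (ν : Measure 𝒳) [IsProbabilityMeasure ν]
    {𝒜 : Type*} [Fintype 𝒜] [DecidableEq 𝒜] [MeasurableSpace 𝒜] [MeasurableSingletonClass 𝒜]
    (K : ℕ) (hK : K = Fintype.card 𝒜) (hK2 : 2 ≤ K)
    (d : ℕ) (φ : 𝒳 → 𝒜 → (Fin d → ℝ))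
    (hφ_meas : ∀ a i, Measurable fun x => φ x a i)
    (B : ℝ) (hB : ∀ x a, ∑ i, φ x a i ^ 2 ≤ B)
    (n : ℕ) (θ : ℕ → Fin d → ℝ)
    (hθ : ∀ t x a, (∑ i, θ t i * φ x a i) ∈ Set.Icc (0 : ℝ) 1)
    (πB : 𝒳 → 𝒜 → ℝ) (hπB_nonneg : ∀ x a, 0 ≤ πB x a) (hπB_sum : ∀ x, ∑ a, πB x a = 1)
    (hπB_meas : ∀ a, Measurable fun x => πB x a)
    (πstar : 𝒳 → 𝒜 → ℝ) (hπstar_nonneg : ∀ x a, 0 ≤ πstar x a)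
    (hπstar_sum : ∀ x, ∑ a, πstar x a = 1)
    (hπstar_meas : ∀ a, Measurable fun x => πstar x a)
    (Vbar : (𝒳 → 𝒜 → ℝ) → Matrix (Fin d) (Fin d) ℝ)
    (hVbar : ∀ π i j, Vbar π i j = ∫ x, ∑ a, π x a * (φ x a i * φ x a j) ∂ν)
    (hdet : (Vbar πB).det ≠ 0)
    (hHerm : (Vbar πB).IsHermitian)
    (η : ℝ) (hη : 0 < η)
    (hlammin : ∀ i, 2 * η * B ≤ hHerm.eigenvalues i)
    (X : ℕ → Ω → 𝒳) (AB : ℕ → Ω → 𝒜)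
    (hX_meas : ∀ t, Measurable (X t)) (hAB_meas : ∀ t, Measurable (AB t))
    (h_indep : iIndepFun (fun t ω => (X t ω, AB t ω)) μ)
    (h_law : ∀ t (S : Set 𝒳), MeasurableSet S → ∀ a,
      μ {ω | X t ω ∈ S ∧ AB t ω = a} = ∫⁻ x in S, ENNReal.ofReal (πB x a) ∂ν)
    (RB : ℕ → Ω → ℝ) (hRB : ∀ t ω, RB t ω = ∑ i, θ t i * φ (X t ω) (AB t ω) i)
    (θhat : ℕ → Ω → Fin d → ℝ)
    (hθhat : ∀ t ω,
      θhat t ω = (Vbar πB)⁻¹.mulVec fun i => φ (X t ω) (AB t ω) i * RB t ω)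
    (w : ℕ → 𝒳 → 𝒜 → Ω → ℝ)
    (hw : ∀ t x a ω,
      w t x a ω = ∏ k ∈ Finset.range t, (1 + η * ∑ i, θhat k ω i * φ x a i))
    (pol : ℕ → 𝒳 → 𝒜 → Ω → ℝ)
    (hpol : ∀ t x a ω, pol t x a ω = w t x a ω / ∑ a', w t x a' ω)
    (Cφ : ℝ) (hCφ : Cφ = Matrix.trace ((Vbar πB)⁻¹ * Vbar πstar)) :
    (∫ ω, ∑ t ∈ Finset.range n, ∑ a,
        (πstar (X t ω) a - pol t (X t ω) a ω) * (∑ i, θ t i * φ (X t ω) a i) ∂μ) ≤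
      Real.log K / η + η * n * Cφ := by
  classical
  have hcard : 0 < Fintype.card 𝒜 := by omega
  have : Nonempty 𝒜 := Fintype.card_pos_iff.1 hcard
  set V := Vbar πB with hVdef
  have hVV : V * V⁻¹ = 1 := mul_nonsing_inv _ (isUnit_iff_ne_zero.2 hdet)
  have hVt : Vᵀ = V := by rw [← conjTranspose_eq_transpose_of_trivial]; exact hHerm
  have hVit : (V⁻¹)ᵀ = V⁻¹ := by rw [transpose_nonsing_inv, hVt]
  have hφB : ∀ x a, φ x a ⬝ᵥ φ x a ≤ B := fun x a => by
    simpa [dotProduct, sq] using hB x a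
  obtain ⟨x0⟩ : Nonempty 𝒳 := by
    by_contra h
    rw [not_nonempty_iff] at h
    have := measure_univ (μ := ν)
    rw [Set.univ_eq_empty_iff.2 h] at this
    simp at this
  -- elementary quantities
  let r : ℕ → 𝒳 → 𝒜 → ℝ := fun t x a => ∑ i, θ t i * φ x a i
  let q : 𝒳 → 𝒜 → Fin d → ℝ := fun x a => V⁻¹ *ᵥ φ x a
  let Y : ℕ → 𝒳 × 𝒜 → 𝒳 → 𝒜 → ℝ := fun t z x a => r t z.1 z.2 * (φ z.1 z.2 ⬝ᵥ q x a)
  let Z : ℕ → Ω → 𝒳 × 𝒜 := fun t ω => (X t ω, AB t ω)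
  have hr0 : ∀ t x a, 0 ≤ r t x a := fun t x a => (hθ t x a).1
  have hr1 : ∀ t x a, r t x a ≤ 1 := fun t x a => (hθ t x a).2
  have hYeq : ∀ t ω x a, ∑ i, θhat t ω i * φ x a i = Y t (Z t ω) x a := by
    intro t ω x a
    have e1 : (fun i => φ (X t ω) (AB t ω) i * RB t ω) = RB t ω • φ (X t ω) (AB t ω) := by
      ext i; simp [mul_comm]
    change θhat t ω ⬝ᵥ φ x a = _
    rw [hθhat, e1, mulVec_smul, smul_dotProduct, hRB, smul_eq_mul]
    change _ = r t (X t ω) (AB t ω) * (φ (X t ω) (AB t ω) ⬝ᵥ (V⁻¹ *ᵥ φ x a))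
    congr 1
    rw [dotProduct_mulVec, ← mulVec_transpose, hVit]
  have hYb : ∀ t z x a, |η * Y t z x a| ≤ 1/2 := by
    intro t z x a
    have h := lp_bound V hHerm hdet η B hη hlammin _ _ (hφB z.1 z.2) (hφB x a)
    have e : η * Y t z x a = r t z.1 z.2 * (η * (φ z.1 z.2 ⬝ᵥ (V⁻¹ *ᵥ φ x a))) := by
      simp only [Y, q]; ring
    rw [e, abs_mul, abs_of_nonneg (hr0 t _ _)]
    calc _ ≤ 1 * |η * (φ z.1 z.2 ⬝ᵥ (V⁻¹ *ᵥ φ x a))| :=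
          mul_le_mul_of_nonneg_right (hr1 _ _ _) (abs_nonneg _)
      _ ≤ 1/2 := by rw [one_mul]; exact h
  have hYb' : ∀ t z x a, |Y t z x a| ≤ 1 / (2 * η) := by
    intro t z x a
    have h := hYb t z x a
    rw [abs_mul, abs_of_pos hη] at h
    rw [le_div_iff₀ (by positivity)]
    linarith
  have hφb : ∀ x a i j, |φ x a i * φ x a j| ≤ B := by
    intro x a i j
    have h1 : ∀ i, φ x a i ^ 2 ≤ B := fun i =>
      (Finset.single_le_sum (f := fun i => φ x a i ^ 2) (fun i _ => sq_nonneg _) (Finset.mem_univ i)).trans (hB x a)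
    rw [abs_le]
    constructor <;> nlinarith [h1 i, h1 j, sq_nonneg (φ x a i + φ x a j), sq_nonneg (φ x a i - φ x a j)]
  -- measurability
  have hφm : ∀ i, Measurable fun z : 𝒳 × 𝒜 => φ z.1 z.2 i := fun i =>
    measurable_from_prod_countable_left fun a => hφ_meas a i
  have hrm : ∀ t, Measurable fun z : 𝒳 × 𝒜 => r t z.1 z.2 := fun t =>
    Finset.measurable_sum _ fun i _ => (hφm i).const_mul _
  have hrm' : ∀ t a, Measurable fun x => r t x a := fun t a =>
    Finset.measurable_sum _ fun i _ => (hφ_meas a i).const_mul _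
  have hqm : ∀ a i, Measurable fun x => q x a i := fun a i => by
    simp only [q, mulVec, dotProduct]
    exact Finset.measurable_sum _ fun j _ => (hφ_meas a j).const_mul _
  have hYm : ∀ t a, Measurable fun p : (𝒳 × 𝒜) × 𝒳 => Y t p.1 p.2 a := fun t a =>
    ((hrm t).comp measurable_fst).mul
      (Finset.measurable_sum _ fun i _ => ((hφm i).comp measurable_fst).mul ((hqm a i).comp measurable_snd))
  have hZm : ∀ t, Measurable (Z t) := fun t => (hX_meas t).prodMk (hAB_meas t)
  -- history
  let H : (t : ℕ) → Ω → (Finset.range t → 𝒳 × 𝒜) := fun t ω k => Z k ω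
  have hHm : ∀ t, Measurable (H t) := fun t => measurable_pi_lambda _ fun k => hZm k
  have hHZ : ∀ t, IndepFun (H t) (Z t) μ := by
    intro t
    have h := h_indep.indepFun_finset (Finset.range t) {t} (by simp) hZm
    exact h.comp (φ := id) (ψ := fun f : ({t} : Finset ℕ) → 𝒳 × 𝒜 => f ⟨t, by simp⟩)
      measurable_id (measurable_pi_apply _)
  have hHX : ∀ t, IndepFun (H t) (X t) μ := fun t =>
    (hHZ t).comp (φ := id) (ψ := Prod.fst) measurable_id measurable_fst
  have hmapX : ∀ t, μ.map (X t) = ν := fun t =>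
    lp_mapX μ ν πB hπB_nonneg hπB_sum hπB_meas (X t) (AB t) (hX_meas t) (hAB_meas t) (h_law t)
  let Wf : (t : ℕ) → 𝒜 → (Finset.range t → 𝒳 × 𝒜) × 𝒳 → ℝ := fun t a p =>
    ∏ k : Finset.range t, (1 + η * Y k (p.1 k) p.2 a)
  let G : (t : ℕ) → 𝒜 → (Finset.range t → 𝒳 × 𝒜) × 𝒳 → ℝ := fun t a p =>
    Wf t a p / ∑ a', Wf t a' p
  have hWm : ∀ t a, Measurable (Wf t a) := fun t a => by
    refine Finset.measurable_prod _ fun k _ => ?_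
    have h1 : Measurable fun p : (Finset.range t → 𝒳 × 𝒜) × 𝒳 => (p.1 k, p.2) :=
      ((measurable_pi_apply k).comp measurable_fst).prodMk measurable_snd
    have h2 : Measurable fun p : (Finset.range t → 𝒳 × 𝒜) × 𝒳 => Y k (p.1 k) p.2 a :=
      (hYm k a).comp h1
    exact (h2.const_mul η).const_add 1
  have hGm : ∀ t a, Measurable (G t a) := fun t a =>
    (hWm t a).div (Finset.measurable_sum _ fun a' _ => hWm t a')
  have hW0 : ∀ t a p, 0 < Wf t a p := fun t a p =>
    Finset.prod_pos fun k _ => by have := (abs_le.1 (hYb k (p.1 k) p.2 a)).1; linarith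
  have hG0 : ∀ t a p, 0 ≤ G t a p := fun t a p =>
    div_nonneg (hW0 t a p).le (Finset.sum_nonneg fun a' _ => (hW0 t a' p).le)
  have hG1 : ∀ t a p, G t a p ≤ 1 := fun t a p =>
    div_le_one_of_le₀ (Finset.single_le_sum (fun a' _ => (hW0 t a' p).le) (Finset.mem_univ a))
      (Finset.sum_nonneg fun a' _ => (hW0 t a' p).le)
  have hweq : ∀ t x a ω, w t x a ω = Wf t a (H t ω, x) := by
    intro t x a ω
    rw [hw]
    simp_rw [hYeq]
    exact (Finset.prod_coe_sort (Finset.range t) fun k => 1 + η * Y k (Z k ω) x a).symm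
  have hpoleq : ∀ t x a ω, pol t x a ω = G t a (H t ω, x) := by
    intro t x a ω
    rw [hpol]
    simp_rw [hweq]
    rfl
  have hs1 : ∀ x a, πstar x a ≤ 1 := fun x a => by
    rw [← hπstar_sum x]
    exact Finset.single_le_sum (fun a' _ => hπstar_nonneg x a') (Finset.mem_univ a)
  have hb1 : ∀ x a, πB x a ≤ 1 := fun x a => by
    rw [← hπB_sum x]
    exact Finset.single_le_sum (fun a' _ => hπB_nonneg x a') (Finset.mem_univ a)
  have hdiff : ∀ t a p, |πstar p.2 a - G t a p| ≤ 1 := fun t a p => by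
    rw [abs_le]
    constructor <;> linarith [hG0 t a p, hG1 t a p, hs1 p.2 a, hπstar_nonneg p.2 a]
  let g : (t : ℕ) → (Finset.range t → 𝒳 × 𝒜) × 𝒳 → ℝ := fun t p =>
    ∑ a, (πstar p.2 a - G t a p) * r t p.2 a
  have hdm : ∀ t a, Measurable fun p => πstar p.2 a - G t a p := fun t a =>
    ((hπstar_meas a).comp measurable_snd).sub (hGm t a)
  have hgm : ∀ t, Measurable (g t) := fun t =>
    Finset.measurable_sum _ fun a _ => (hdm t a).mul ((hrm' t a).comp measurable_snd)
  have hgb : ∀ t p, |g t p| ≤ Fintype.card 𝒜 := fun t p => by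
    refine (Finset.abs_sum_le_sum_abs _ _).trans ?_
    calc _ ≤ ∑ a : 𝒜, (1 : ℝ) := by
          refine Finset.sum_le_sum fun a _ => ?_
          rw [abs_mul, abs_of_nonneg (hr0 t _ _)]
          exact mul_le_one₀ (hdiff t a p) (hr0 _ _ _) (hr1 _ _ _)
      _ = _ := by simp
  -- integrability tools
  have bddμ : ∀ (f : Ω → ℝ) (C : ℝ), Measurable f → (∀ ω, |f ω| ≤ C) → Integrable f μ :=
    fun f C hf hC => Integrable.of_bound hf.aestronglyMeasurable C
      (Filter.Eventually.of_forall fun ω => by simpa using hC ω)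
  have bddν : ∀ (f : 𝒳 → ℝ) (C : ℝ), Measurable f → (∀ ω, |f ω| ≤ C) → Integrable f ν :=
    fun f C hf hC => Integrable.of_bound hf.aestronglyMeasurable C
      (Filter.Eventually.of_forall fun ω => by simpa using hC ω)
  have hintπ : ∀ (π : 𝒳 → 𝒜 → ℝ), (∀ x a, 0 ≤ π x a) → (∀ x a, π x a ≤ 1) →
      (∀ a, Measurable fun x => π x a) → ∀ (f : 𝒳 → 𝒜 → ℝ) (C : ℝ), (∀ a, Measurable fun x => f x a) →
      (∀ x a, |f x a| ≤ C) → ∀ a, Integrable (fun x => π x a * f x a) ν := by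
    intro π h0 h1 hm f C hf hC a
    refine bddν _ C ((hm a).mul (hf a)) fun x => ?_
    rw [abs_mul, abs_of_nonneg (h0 x a)]
    calc _ ≤ 1 * |f x a| := mul_le_mul_of_nonneg_right (h1 _ _) (abs_nonneg _)
      _ ≤ C := by rw [one_mul]; exact hC x a
  have hintφ : ∀ (π : 𝒳 → 𝒜 → ℝ), (∀ x a, 0 ≤ π x a) → (∀ x a, π x a ≤ 1) →
      (∀ a, Measurable fun x => π x a) → ∀ a i j,
      Integrable (fun x => π x a * (φ x a i * φ x a j)) ν := fun π h0 h1 hm a i j =>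
    hintπ π h0 h1 hm (fun x a => φ x a i * φ x a j) B
      (fun a => (hφ_meas a i).mul (hφ_meas a j)) (fun x a => hφb x a i j) a
  have hquad : ∀ (M : Matrix (Fin d) (Fin d) ℝ) a, Measurable fun x => φ x a ⬝ᵥ (M *ᵥ φ x a) :=
    fun M a => by
      simp only [mulVec, dotProduct]
      exact Finset.measurable_sum _ fun i _ => (hφ_meas a i).mul
       (Finset.measurable_sum _ fun j _ => (hφ_meas a j).const_mul _)
  have hquadb : ∀ (M : Matrix (Fin d) (Fin d) ℝ) x a,
      |φ x a ⬝ᵥ (M *ᵥ φ x a)| ≤ ∑ i, ∑ j, |M i j| * B := by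
    intro M x a
    have e : φ x a ⬝ᵥ (M *ᵥ φ x a) = ∑ i, ∑ j, M i j * (φ x a i * φ x a j) := by
      simp only [dotProduct, mulVec, Finset.mul_sum]
      refine Finset.sum_congr rfl fun i _ => Finset.sum_congr rfl fun j _ => ?_
      ring
    rw [e]
    refine (Finset.abs_sum_le_sum_abs _ _).trans (Finset.sum_le_sum fun i _ => ?_)
    refine (Finset.abs_sum_le_sum_abs _ _).trans (Finset.sum_le_sum fun j _ => ?_)
    rw [abs_mul]
    exact mul_le_mul_of_nonneg_left (hφb x a i j) (abs_nonneg _)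
  -- moments
  have hmom : ∀ t (p q : Fin d → ℝ),
      ∫ ω, (p ⬝ᵥ φ (X t ω) (AB t ω)) * (φ (X t ω) (AB t ω) ⬝ᵥ q) ∂μ = p ⬝ᵥ (V *ᵥ q) := by
    intro t p q
    simp_rw [← lp_rank_one]
    rw [lp_law μ ν πB hπB_nonneg hπB_meas (X t) (AB t) (hX_meas t) (hAB_meas t) (h_law t)
      (fun x a => φ x a ⬝ᵥ (vecMulVec p q *ᵥ φ x a)) (hquad _) _ (hquadb _)
      (hintπ πB hπB_nonneg hb1 hπB_meas _ _ (hquad _) (hquadb _)),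
      lp_moment ν φ πB V (hVbar πB) (hintφ πB hπB_nonneg hb1 hπB_meas), lp_trace_rank_one _ _ _ hHerm]
  have hVq : ∀ x a, V *ᵥ q x a = φ x a := fun x a => by
    simp only [q]; rw [mulVec_mulVec, hVV, one_mulVec]
  have hEY : ∀ t x a, ∫ ω, Y t (Z t ω) x a ∂μ = r t x a := by
    intro t x a
    have := hmom t (θ t) (q x a)
    rw [hVq] at this
    exact this
  have hYZm : ∀ t x a, Measurable fun ω => Y t (Z t ω) x a := fun t x a =>
    (hYm t a).comp ((hZm t).prodMk measurable_const)
  have hYi : ∀ t x a, Integrable (fun ω => Y t (Z t ω) x a) μ := fun t x a =>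
    bddμ _ _ (hYZm t x a) fun ω => hYb' t _ x a
  have hY2i : ∀ t x a, Integrable (fun ω => Y t (Z t ω) x a ^ 2) μ := fun t x a =>
    bddμ _ ((1 / (2 * η))^2) ((hYZm t x a).pow_const 2) fun ω => by
      rw [abs_pow]; exact pow_le_pow_left₀ (abs_nonneg _) (hYb' t _ x a) 2
  have hEY2 : ∀ t x a, ∫ ω, Y t (Z t ω) x a ^ 2 ∂μ ≤ φ x a ⬝ᵥ (V⁻¹ *ᵥ φ x a) := by
    intro t x a
    have h := hmom t (q x a) (q x a)
    rw [hVq] at h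
    have e : q x a ⬝ᵥ φ x a = φ x a ⬝ᵥ (V⁻¹ *ᵥ φ x a) := dotProduct_comm _ _
    rw [← e, ← h]
    have hpt : ∀ ω, (q x a ⬝ᵥ φ (X t ω) (AB t ω)) * (φ (X t ω) (AB t ω) ⬝ᵥ q x a) =
        (φ (X t ω) (AB t ω) ⬝ᵥ q x a)^2 := fun ω => by
      rw [dotProduct_comm (q x a), sq]
    simp_rw [hpt]
    refine integral_mono (hY2i t x a) ?_ fun ω => ?_
    · have hb := fun ω => lp_bound V hHerm hdet η B hη hlammin _ _ (hφB (X t ω) (AB t ω)) (hφB x a)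
      refine bddμ _ ((1 / (2 * η))^2) (Measurable.pow_const
        (Finset.measurable_sum _ fun i _ => ((hφm i).comp (hZm t)).mul_const _) 2) fun ω => ?_
      rw [abs_pow]
      refine pow_le_pow_left₀ (abs_nonneg _) ?_ 2
      have h := hb ω
      rw [abs_mul, abs_of_pos hη] at h
      rw [le_div_iff₀ (by positivity)]
      change |φ (X t ω) (AB t ω) ⬝ᵥ (V⁻¹ *ᵥ φ x a)| * (2 * η) ≤ 1
      linarith
    · change (r t (X t ω) (AB t ω) * (φ (X t ω) (AB t ω) ⬝ᵥ q x a))^2 ≤ _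
      rw [mul_pow]
      exact mul_le_of_le_one_left (sq_nonneg _) (pow_le_one₀ (hr0 _ _ _) (hr1 _ _ _))
  -- replacing rewards by their estimates
  have hDi : ∀ t x a, Integrable (fun ω => (πstar x a - pol t x a ω) * Y t (Z t ω) x a) μ := by
    intro t x a
    simp_rw [hpoleq]
    refine bddμ _ (1 * (1 / (2 * η))) (((hdm t a).comp ((hHm t).prodMk measurable_const)).mul
      (hYZm t x a)) fun ω => ?_
    rw [abs_mul]
    exact mul_le_mul (hdiff t a (H t ω, x)) (hYb' _ _ _ _) (abs_nonneg _) zero_le_one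
  have hswap : ∀ t x, ∫ ω, g t (H t ω, x) ∂μ =
      ∫ ω, ∑ a, (πstar x a - pol t x a ω) * Y t (Z t ω) x a ∂μ := by
    intro t x
    have hd : ∀ a, Measurable fun ω => πstar x a - G t a (H t ω, x) := fun a =>
      (hdm t a).comp ((hHm t).prodMk measurable_const)
    rw [integral_finsetSum _ fun a _ => hDi t x a, integral_finsetSum]
    · refine Finset.sum_congr rfl fun a _ => ?_
      simp_rw [hpoleq]
      have hind : IndepFun (fun ω => πstar x a - G t a (H t ω, x)) (fun ω => Y t (Z t ω) x a) μ :=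
        (hHZ t).comp (φ := fun h => πstar x a - G t a (h, x)) (ψ := fun z => Y t z x a)
          ((hdm t a).comp (measurable_id.prodMk measurable_const))
          ((hYm t a).comp (measurable_id.prodMk measurable_const))
      rw [hind.integral_fun_mul_eq_mul_integral (hd a).aestronglyMeasurable
        (hYZm t x a).aestronglyMeasurable, hEY, integral_mul_const]
    · intro a _
      exact (bddμ _ 1 (hd a) fun ω => hdiff t a (H t ω, x)).mul_const (r t x a)
  -- per-context bound
  have hctx : ∀ x, ∑ t ∈ Finset.range n, ∫ ω, g t (H t ω, x) ∂μ ≤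
      Real.log K / η + η * (n * ∑ a, πstar x a * (φ x a ⬝ᵥ (V⁻¹ *ᵥ φ x a))) := by
    intro x
    simp_rw [hswap]
    rw [← integral_finsetSum _ fun t _ => integrable_finsetSum _ fun a _ => hDi t x a]
    have hi2 : ∀ t, Integrable (fun ω => ∑ a, πstar x a * Y t (Z t ω) x a ^ 2) μ := fun t =>
      integrable_finsetSum _ fun a _ => (hY2i t x a).const_mul _
    have hi3 : Integrable (fun ω => ∑ t ∈ Finset.range n, ∑ a, πstar x a * Y t (Z t ω) x a ^ 2) μ :=
      integrable_finsetSum _ fun t _ => hi2 t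
    calc _ ≤ ∫ ω, (Real.log K / η + η * ∑ t ∈ Finset.range n, ∑ a, πstar x a * Y t (Z t ω) x a ^ 2) ∂μ := by
          refine integral_mono (integrable_finsetSum _ fun t _ => integrable_finsetSum _ fun a _ => hDi t x a)
            ((integrable_const _).add (hi3.const_mul _)) fun ω => ?_
          have := lp_potential η hη n (fun t a => Y t (Z t ω) x a) (fun t a => hYb t _ x a)
            (πstar x) (hπstar_nonneg x) (hπstar_sum x) (fun t a => w t x a ω)
            (fun t a => by rw [hw]; simp_rw [hYeq]) (fun t a => pol t x a ω) (fun t a => hpol t x a ω)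
          rw [← hK] at this
          exact this
      _ = Real.log K / η + η * ∑ t ∈ Finset.range n, ∑ a, πstar x a * ∫ ω, Y t (Z t ω) x a ^ 2 ∂μ := by
          rw [integral_add (integrable_const _) (hi3.const_mul _), integral_const_mul,
            integral_finsetSum _ fun t _ => hi2 t]
          simp only [integral_const, probReal_univ, one_smul]
          congr 2
          refine Finset.sum_congr rfl fun t _ => ?_
          rw [integral_finsetSum _ fun a _ => (hY2i t x a).const_mul _]
          exact Finset.sum_congr rfl fun a _ => integral_const_mul _ _
      _ ≤ _ := by
          have : ∑ t ∈ Finset.range n, ∑ a, πstar x a * ∫ ω, Y t (Z t ω) x a ^ 2 ∂μ ≤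
              ∑ t ∈ Finset.range n, ∑ a, πstar x a * (φ x a ⬝ᵥ (V⁻¹ *ᵥ φ x a)) :=
            Finset.sum_le_sum fun t _ => Finset.sum_le_sum fun a _ =>
              mul_le_mul_of_nonneg_left (hEY2 t x a) (hπstar_nonneg x a)
          rw [Finset.sum_const, Finset.card_range, nsmul_eq_mul] at this
          have := mul_le_mul_of_nonneg_left this hη.le
          linarith
  -- assembling
  have hdec := fun t => lp_decouple μ ν (H t) (X t) (hHm t) (hX_meas t) (hHX t) (hmapX t) (g t)
    (hgm t) _ (hgb t)
  have hLHS : ∀ ω, ∑ t ∈ Finset.range n, ∑ a,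
        (πstar (X t ω) a - pol t (X t ω) a ω) * (∑ i, θ t i * φ (X t ω) a i) =
      ∑ t ∈ Finset.range n, g t (H t ω, X t ω) := by
    intro ω
    simp_rw [hpoleq]
    rfl
  simp_rw [hLHS]
  have hgi : ∀ t, Integrable (fun ω => g t (H t ω, X t ω)) μ := fun t =>
    bddμ _ _ ((hgm t).comp ((hHm t).prodMk (hX_meas t))) fun ω => hgb t _
  rw [integral_finsetSum _ fun t _ => hgi t,
    Finset.sum_congr rfl fun t _ => (hdec t).1, ← integral_finsetSum _ fun t _ => (hdec t).2]
  have hqi : Integrable (fun x => ∑ a, πstar x a * (φ x a ⬝ᵥ (V⁻¹ *ᵥ φ x a))) ν :=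
    integrable_finsetSum _ fun a _ =>
      hintπ πstar hπstar_nonneg hs1 hπstar_meas _ _ (hquad V⁻¹) (hquadb V⁻¹) a
  calc _ ≤ ∫ x, (Real.log K / η + η * (n * ∑ a, πstar x a * (φ x a ⬝ᵥ (V⁻¹ *ᵥ φ x a)))) ∂ν :=
        integral_mono (integrable_finsetSum _ fun t _ => (hdec t).2)
          ((integrable_const _).add ((hqi.const_mul _).const_mul _)) hctx
    _ = _ := by
        rw [integral_add (integrable_const _) ((hqi.const_mul _).const_mul _), integral_const_mul,
          integral_const_mul, lp_moment ν φ πstar (Vbar πstar) (hVbar πstar)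
            (hintφ πstar hπstar_nonneg hs1 hπstar_meas), hCφ]
        simp only [integral_const, probReal_univ, one_smul]
        ring
end

section
/- Suppose the learning rate η = √(log(K)/n) satisfies λ_min(V̄(π_B)) ≥ 2η·sup_{x,a} ‖φ(x,a)‖₂². Then for any comparator policy π* the expected regret of LinProd satisfies E[R(π*)] ≤ √(n·log K)·(1 + C_φ(π*;π_B)), where C_φ(π*;π_B) = Tr(V̄(π_B)^{-1}·V̄(π*)) is the feature coverage ratio. -/
open MeasureTheory ProbabilityTheory Matrix

lemma aux_log {x : ℝ} (h : |x| ≤ 1/2) : x - x^2 ≤ Real.log (1 + x) := by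
  have := abs_le.1 h
  rcases le_or_gt 0 x with h0 | h0
  · have h1 := Real.le_log_one_add_of_nonneg h0
    refine le_trans ?_ h1
    rw [le_div_iff₀ (by linarith)]
    nlinarith [mul_nonneg h0 h0, mul_nonneg h0 (mul_nonneg h0 h0)]
  · have h2 := Real.abs_log_sub_add_sum_range_le (x := -x) (by rw [abs_neg]; linarith [abs_nonneg x]) 4
    simp only [Finset.sum_range_succ, Finset.sum_range_zero, abs_neg] at h2
    have h3 := (abs_le.1 h2).1
    have h5 : |x|^5/(1-|x|) ≤ 2 * (-x)^5 := by
      rw [div_le_iff₀ (by linarith), abs_of_neg h0]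
      have : 0 ≤ (-x)^5 := by apply pow_nonneg; linarith
      nlinarith
    norm_num at h3 h5
    obtain ⟨u, rfl⟩ : ∃ u, x = -u := ⟨-x, by ring⟩
    norm_num at h3 h5
    have hu : 0 < u := by linarith
    have hu2 : u ≤ 1/2 := by linarith
    have e1 : u^3 ≤ u^2 * (1/2) := by nlinarith [mul_nonneg (sq_nonneg u) (sub_nonneg.2 hu2)]
    have e2 : u^4 ≤ u^2 * (1/4) := by nlinarith [mul_nonneg (pow_nonneg hu.le 3) (sub_nonneg.2 hu2)]
    have e3 : u^5 ≤ u^2 * (1/8) := by nlinarith [mul_nonneg (pow_nonneg hu.le 4) (sub_nonneg.2 hu2)]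
    have e4 : Real.log (1 + -u) = Real.log (1 - u) := by ring_nf
    have e0 := sq_nonneg u
    nlinarith

lemma aux_matrix {d : ℕ} (V : Matrix (Fin d) (Fin d) ℝ) (hV : V.IsHermitian) (hdet : V.det ≠ 0)
    (η B : ℝ) (hη : 0 < η) (hl : ∀ i, 2 * η * B ≤ hV.eigenvalues i) (u v : Fin d → ℝ)
    (hu : ∑ i, u i ^ 2 ≤ B) (hv : ∑ i, v i ^ 2 ≤ B) :
    |(u ᵥ* V⁻¹) ⬝ᵥ v| * η ≤ 1 / 2 := by
  have hB : 0 ≤ B := le_trans (Finset.sum_nonneg fun i _ => sq_nonneg _) hu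
  have key : ∀ y : Fin d → ℝ, 2 * η * B * ∑ i, y i ^ 2 ≤ y ⬝ᵥ V *ᵥ y := by
    intro y
    have hc : (V - algebraMap ℝ (Matrix (Fin d) (Fin d) ℝ) (2 * η * B)).IsHermitian := by
      apply hV.sub
      rw [Matrix.algebraMap_eq_diagonal]
      exact Matrix.isHermitian_diagonal _
    have hps : (V - algebraMap ℝ (Matrix (Fin d) (Fin d) ℝ) (2 * η * B)).PosSemidef := by
      rw [hc.posSemidef_iff_eigenvalues_nonneg]
      intro i
      have h1 := hc.eigenvalues_mem_spectrum_real i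
      rw [← spectrum.sub_singleton_eq, hV.spectrum_real_eq_range_eigenvalues] at h1
      obtain ⟨_, ⟨j, rfl⟩, _, rfl, h3⟩ := h1
      have := hl j
      simp only at h3
      rw [← h3]
      simpa using this
    have h4 := hps.dotProduct_mulVec_nonneg y
    rw [Matrix.sub_mulVec, dotProduct_sub] at h4
    simp only [star_trivial, Algebra.algebraMap_eq_smul_one, smul_mulVec, one_mulVec, dotProduct_smul] at h4
    have h5 : y ⬝ᵥ y = ∑ i, y i ^ 2 := by simp [dotProduct, sq]
    rw [h5, smul_eq_mul] at h4
    linarith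
  rw [← dotProduct_mulVec]
  set y := V⁻¹ *ᵥ v with hy
  have hVy : V *ᵥ y = v := by
    rw [hy, mulVec_mulVec, mul_nonsing_inv _ (isUnit_iff_ne_zero.2 hdet), one_mulVec]
  have k := key y
  rw [hVy] at k
  have c1 : (y ⬝ᵥ v)^2 ≤ (∑ i, y i ^ 2) * ∑ i, v i ^ 2 := Finset.sum_mul_sq_le_sq_mul_sq _ _ _
  have c2 : (u ⬝ᵥ y)^2 ≤ (∑ i, u i ^ 2) * ∑ i, y i ^ 2 := Finset.sum_mul_sq_le_sq_mul_sq _ _ _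
  set Y := ∑ i, y i ^ 2 with hY
  have hY0 : 0 ≤ Y := Finset.sum_nonneg fun i _ => sq_nonneg _
  have c3 : (2 * η * B * Y)^2 ≤ Y * B := by
    calc _ ≤ (y ⬝ᵥ v)^2 := by gcongr
      _ ≤ _ := c1
      _ ≤ _ := by gcongr
  have c4 : (u ⬝ᵥ y)^2 ≤ B * Y := c2.trans (by gcongr)
  have c5 : (|u ⬝ᵥ y| * η)^2 ≤ (1/2)^2 := by
    rw [mul_pow, sq_abs]
    rcases (mul_nonneg hB hY0).eq_or_lt with h | h
    · rw [← h] at c4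
      nlinarith [sq_nonneg η, sq_nonneg (u ⬝ᵥ y), mul_nonneg (sub_nonneg.2 c4) (sq_nonneg η)]
    · have : 4 * η^2 * (B * Y) ≤ 1 := by
        by_contra! hc
        nlinarith [mul_lt_mul_of_pos_right hc h]
      nlinarith [mul_le_mul_of_nonneg_right c4 (sq_nonneg η)]
  exact le_of_abs_le (abs_le_of_sq_le_sq c5 (by norm_num)) 

lemma aux_det {𝒜 : Type*} [Fintype 𝒜] [Nonempty 𝒜] (n : ℕ) (η : ℝ) (hη : 0 < η)
    (z : ℕ → 𝒜 → ℝ) (hz : ∀ t a, |z t a| * η ≤ 1/2) (w p : ℕ → 𝒜 → ℝ)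
    (hw : ∀ t a, w t a = ∏ k ∈ Finset.range t, (1 + η * z k a))
    (hp : ∀ t a, p t a = w t a / ∑ b, w t b) (q : 𝒜 → ℝ) (hq : ∀ a, 0 ≤ q a) (hq1 : ∑ a, q a = 1) :
    ∑ t ∈ Finset.range n, ∑ a, (q a - p t a) * z t a ≤
      Real.log (Fintype.card 𝒜) / η + η * ∑ t ∈ Finset.range n, ∑ a, q a * z t a ^ 2 := by
  have hz' : ∀ t a, |η * z t a| ≤ 1/2 := fun t a => by
    rw [abs_mul, abs_of_pos hη, mul_comm]; exact hz t a
  have hf : ∀ t a, 0 < 1 + η * z t a := fun t a => by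
    have := (abs_le.1 (hz' t a)).1; linarith
  have hwp : ∀ t a, 0 < w t a := fun t a => by
    rw [hw]; exact Finset.prod_pos fun k _ => hf k a
  have hW : ∀ t, 0 < ∑ b, w t b := fun t => Finset.sum_pos (fun a _ => hwp t a) Finset.univ_nonempty
  have hws : ∀ t a, w (t+1) a = w t a * (1 + η * z t a) := fun t a => by
    rw [hw, hw, Finset.prod_range_succ]
  have hup : ∀ m, Real.log (∑ b, w m b) ≤ Real.log (Fintype.card 𝒜)
      + η * ∑ t ∈ Finset.range m, ∑ a, p t a * z t a := by
    intro m
    induction m with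
    | zero => simp [hw]
    | succ m ih =>
      have h1 : ∑ b, w (m+1) b = (∑ b, w m b) * (1 + η * ∑ a, p m a * z m a) := by
        have : ∑ a, p m a * z m a = (∑ a, w m a * z m a) / ∑ b, w m b := by
          rw [Finset.sum_div]; exact Finset.sum_congr rfl fun a _ => by rw [hp]; ring
        rw [this]
        simp only [hws]
        have := (hW m).ne'
        field_simp
        rw [Finset.mul_sum, ← Finset.sum_add_distrib]
        exact Finset.sum_congr rfl fun a _ => by ring
      have h2 : 0 < 1 + η * ∑ a, p m a * z m a := by
        have := hW (m+1); rw [h1] at this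
        exact (pos_iff_pos_of_mul_pos this).1 (hW m)
      rw [h1, Real.log_mul (hW m).ne' h2.ne', Finset.sum_range_succ]
      have := Real.log_le_sub_one_of_pos h2
      nlinarith
  have hlow : ∀ a, η * ∑ t ∈ Finset.range n, z t a - η^2 * ∑ t ∈ Finset.range n, z t a ^ 2
      ≤ Real.log (∑ b, w n b) := by
    intro a
    calc _ = ∑ t ∈ Finset.range n, (η * z t a - (η * z t a)^2) := by
          rw [Finset.sum_sub_distrib, Finset.mul_sum, Finset.mul_sum]
          simp only [mul_pow]
      _ ≤ ∑ t ∈ Finset.range n, Real.log (1 + η * z t a) :=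
          Finset.sum_le_sum fun t _ => aux_log (hz' t a)
      _ = Real.log (w n a) := by
          rw [hw, Real.log_prod (fun k _ => (hf k a).ne')]
      _ ≤ _ := Real.log_le_log (hwp n a) (Finset.single_le_sum (fun b _ => (hwp n b).le) (Finset.mem_univ a))
  have hmix : η * ∑ t ∈ Finset.range n, ∑ a, q a * z t a - η^2 * ∑ t ∈ Finset.range n, ∑ a, q a * z t a ^ 2
      ≤ Real.log (∑ b, w n b) := by
    have h := Finset.sum_le_sum fun a (_ : a ∈ Finset.univ) => mul_le_mul_of_nonneg_left (hlow a) (hq a)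
    rw [← Finset.sum_mul, hq1, one_mul] at h
    refine le_trans (le_of_eq ?_) h
    rw [Finset.sum_comm, Finset.sum_comm (f := fun t a => q a * z t a ^ 2), Finset.mul_sum, Finset.mul_sum,
      ← Finset.sum_sub_distrib]
    refine Finset.sum_congr rfl fun a _ => ?_
    rw [← Finset.mul_sum, ← Finset.mul_sum]; ring
  have h := hmix.trans (hup n)
  have e : ∑ t ∈ Finset.range n, ∑ a, (q a - p t a) * z t a =
     ∑ t ∈ Finset.range n, ∑ a, q a * z t a - ∑ t ∈ Finset.range n, ∑ a, p t a * z t a := by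
    simp only [sub_mul, Finset.sum_sub_distrib]
  rw [e]
  rw [← sub_le_iff_le_add, le_div_iff₀ hη]
  nlinarith

lemma aux_law {Ω : Type*} [MeasurableSpace Ω] (μ : Measure Ω) [IsProbabilityMeasure μ]
    {𝒳 : Type*} [MeasurableSpace 𝒳] (ν : Measure 𝒳) [IsProbabilityMeasure ν]
    {𝒜 : Type*} [Fintype 𝒜] [MeasurableSpace 𝒜] [MeasurableSingletonClass 𝒜]
    (πB : 𝒳 → 𝒜 → ℝ) (hπB_nonneg : ∀ x a, 0 ≤ πB x a) (hπB_sum : ∀ x, ∑ a, πB x a = 1)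
    (hπB_meas : ∀ a, Measurable fun x => πB x a)
    (X : Ω → 𝒳) (A : Ω → 𝒜) (hX : Measurable X) (hA : Measurable A)
    (h_law : ∀ (S : Set 𝒳), MeasurableSet S → ∀ a,
      μ {ω | X ω ∈ S ∧ A ω = a} = ∫⁻ x in S, ENNReal.ofReal (πB x a) ∂ν)
    (g : 𝒳 → 𝒜 → ℝ) (hg : ∀ a, Measurable fun x => g x a) (C : ℝ) (hC : ∀ x a, |g x a| ≤ C) :
    ∫ ω, g (X ω) (A ω) ∂μ = ∫ x, ∑ a, πB x a * g x a ∂ν := by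
  classical
  have hs : ∀ a, MeasurableSet {ω | A ω = a} := fun a => hA (measurableSet_singleton a)
  have hmap : ∀ a, (μ.restrict {ω | A ω = a}).map X = ν.withDensity fun x => ENNReal.ofReal (πB x a) := by
    intro a
    ext S hS
    rw [Measure.map_apply hX hS, Measure.restrict_apply (hX hS), withDensity_apply _ hS, ← h_law S hS a]
    rfl
  have hle : ∀ x a, πB x a ≤ 1 := fun x a => by
    rw [← hπB_sum x]; exact Finset.single_le_sum (fun b _ => hπB_nonneg x b) (Finset.mem_univ a)
  have e1 : ∀ ω, g (X ω) (A ω) = ∑ a, Set.indicator {ω | A ω = a} (fun ω => g (X ω) a) ω := by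
    intro ω
    simp [Set.indicator_apply]
  simp only [e1]
  rw [integral_finsetSum, integral_finsetSum]
  · refine Finset.sum_congr rfl fun a _ => ?_
    rw [integral_indicator (hs a), ← integral_map (φ := X) (f := fun x => g x a) hX.aemeasurable
      (hg a).aestronglyMeasurable, hmap,
      integral_withDensity_eq_integral_toReal_smul (hπB_meas a).ennreal_ofReal (by simp)]
    refine integral_congr_ae (.of_forall fun x => ?_)
    simp [ENNReal.toReal_ofReal (hπB_nonneg x a)]
  · intro a _
    refine Integrable.of_bound (C := C) ((hπB_meas a).mul (hg a)).aestronglyMeasurable (.of_forall fun x => ?_)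
    rw [Real.norm_eq_abs, abs_mul, abs_of_nonneg (hπB_nonneg x a)]
    nlinarith [hle x a, hC x a, abs_nonneg (g x a), hπB_nonneg x a]
  · intro a _
    refine Integrable.indicator ?_ (hs a)
    exact Integrable.of_bound (C := C) ((hg a).comp hX).aestronglyMeasurable (.of_forall fun x => hC _ _)

lemma aux_indep {Ω : Type*} [MeasurableSpace Ω] (μ : Measure Ω) [IsProbabilityMeasure μ]
    {H Y : Type*} [MeasurableSpace H] [MeasurableSpace Y] (h : Ω → H) (y : Ω → Y)
    (hh : Measurable h) (hy : Measurable y) (hi : IndepFun h y μ)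
    (F : H → Y → ℝ) (hF : Measurable (Function.uncurry F)) (C : ℝ) (hC : ∀ a b, |F a b| ≤ C) :
    ∫ ω, F (h ω) (y ω) ∂μ = ∫ ω, ∫ b, F (h ω) b ∂(μ.map y) ∂μ := by
  have := Measure.isProbabilityMeasure_map (μ := μ) hh.aemeasurable
  have := Measure.isProbabilityMeasure_map (μ := μ) hy.aemeasurable
  have e := (indepFun_iff_map_prod_eq_prod_map_map hh.aemeasurable hy.aemeasurable).1 hi
  calc _ = ∫ p, Function.uncurry F p ∂(μ.map fun ω => (h ω, y ω)) := by
        rw [integral_map (hh.prodMk hy).aemeasurable hF.aestronglyMeasurable]; rfl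
    _ = ∫ a, ∫ b, F a b ∂(μ.map y) ∂(μ.map h) := by
        rw [e, integral_prod]
        · rfl
        · exact Integrable.of_bound (C := C) hF.aestronglyMeasurable (.of_forall fun x => hC _ _)
    _ = _ := by
        rw [integral_map hh.aemeasurable]
        exact (hF.stronglyMeasurable.integral_prod_right (ν := μ.map y)).aestronglyMeasurable

set_option maxHeartbeats 4000000 in
/-- Theorem 3, uniform tuning: if the learning rate `η = √(log(K)/n)`
satisfies `λ_min(V̄(π_B)) ≥ 2η·sup_{x,a}‖φ(x,a)‖₂²`, then for any comparator policy `π*`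
the expected regret of LinProd is bounded by `√(n·log K)·(1 + C_φ(π*;π_B))`, where
`C_φ(π*;π_B) = Tr(V̄(π_B)⁻¹·V̄(π*))`. -/
theorem linprod_regret_uniform_tuning
    {Ω : Type*} [MeasurableSpace Ω] (μ : Measure Ω) [IsProbabilityMeasure μ]
    {𝒳 : Type*} [MeasurableSpace 𝒳] (ν : Measure 𝒳) [IsProbabilityMeasure ν]
    {𝒜 : Type*} [Fintype 𝒜] [DecidableEq 𝒜] [MeasurableSpace 𝒜] [MeasurableSingletonClass 𝒜]
    (K : ℕ) (hK : K = Fintype.card 𝒜) (hK2 : 2 ≤ K)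
    (d : ℕ) (φ : 𝒳 → 𝒜 → (Fin d → ℝ))
    (hφ_meas : ∀ a i, Measurable fun x => φ x a i)
    (B : ℝ) (hB : ∀ x a, ∑ i, φ x a i ^ 2 ≤ B)
    (n : ℕ) (hn : 0 < n) (θ : ℕ → Fin d → ℝ)
    (hθ : ∀ t x a, (∑ i, θ t i * φ x a i) ∈ Set.Icc (0 : ℝ) 1)
    (πB : 𝒳 → 𝒜 → ℝ) (hπB_nonneg : ∀ x a, 0 ≤ πB x a) (hπB_sum : ∀ x, ∑ a, πB x a = 1)
    (hπB_meas : ∀ a, Measurable fun x => πB x a)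
    (πstar : 𝒳 → 𝒜 → ℝ) (hπstar_nonneg : ∀ x a, 0 ≤ πstar x a)
    (hπstar_sum : ∀ x, ∑ a, πstar x a = 1)
    (hπstar_meas : ∀ a, Measurable fun x => πstar x a)
    (Vbar : (𝒳 → 𝒜 → ℝ) → Matrix (Fin d) (Fin d) ℝ)
    (hVbar : ∀ π i j, Vbar π i j = ∫ x, ∑ a, π x a * (φ x a i * φ x a j) ∂ν)
    (hdet : (Vbar πB).det ≠ 0)
    (hHerm : (Vbar πB).IsHermitian)
    (η : ℝ) (hη : η = Real.sqrt (Real.log K / n))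
    (hlammin : ∀ i, 2 * η * B ≤ hHerm.eigenvalues i)
    (X : ℕ → Ω → 𝒳) (AB : ℕ → Ω → 𝒜)
    (hX_meas : ∀ t, Measurable (X t)) (hAB_meas : ∀ t, Measurable (AB t))
    (h_indep : iIndepFun (fun t ω => (X t ω, AB t ω)) μ)
    (h_law : ∀ t (S : Set 𝒳), MeasurableSet S → ∀ a,
      μ {ω | X t ω ∈ S ∧ AB t ω = a} = ∫⁻ x in S, ENNReal.ofReal (πB x a) ∂ν)
    (RB : ℕ → Ω → ℝ) (hRB : ∀ t ω, RB t ω = ∑ i, θ t i * φ (X t ω) (AB t ω) i)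
    (θhat : ℕ → Ω → Fin d → ℝ)
    (hθhat : ∀ t ω,
      θhat t ω = (Vbar πB)⁻¹.mulVec fun i => φ (X t ω) (AB t ω) i * RB t ω)
    (w : ℕ → 𝒳 → 𝒜 → Ω → ℝ)
    (hw : ∀ t x a ω,
      w t x a ω = ∏ k ∈ Finset.range t, (1 + η * ∑ i, θhat k ω i * φ x a i))
    (pol : ℕ → 𝒳 → 𝒜 → Ω → ℝ)
    (hpol : ∀ t x a ω, pol t x a ω = w t x a ω / ∑ a', w t x a' ω)
    (Cφ : ℝ) (hCφ : Cφ = Matrix.trace ((Vbar πB)⁻¹ * Vbar πstar)) :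
    (∫ ω, ∑ t ∈ Finset.range n, ∑ a,
        (πstar (X t ω) a - pol t (X t ω) a ω) * (∑ i, θ t i * φ (X t ω) a i) ∂μ) ≤
      Real.sqrt (n * Real.log K) * (1 + Cφ) := by
  classical
  have h𝒜 : Nonempty 𝒜 := Fintype.card_pos_iff.1 (by omega)
  have hKr : (2:ℝ) ≤ K := by exact_mod_cast hK2
  have hnr : (0:ℝ) < n := by exact_mod_cast hn
  have hlogK : 0 < Real.log K := Real.log_pos (by linarith)
  have hηp : 0 < η := by rw [hη]; exact Real.sqrt_pos.2 (by positivity)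
  set V := Vbar πB with hVdef
  have hVu : IsUnit V.det := isUnit_iff_ne_zero.2 hdet
  have hVs : Vᵀ = V := by simpa [Matrix.IsHermitian, conjTranspose_eq_transpose_of_trivial] using hHerm
  -- basic bounds
  have hB0 : 0 ≤ B := by
    obtain ⟨x⟩ := (inferInstance : NeZero ν).out |> fun _ => ν.nonempty_of_neZero
    exact le_trans (Finset.sum_nonneg fun i _ => sq_nonneg _) (hB x h𝒜.some)
  have hsle : ∀ x a, πstar x a ≤ 1 := fun x a => by
    rw [← hπstar_sum x]
    exact Finset.single_le_sum (fun b _ => hπstar_nonneg x b) (Finset.mem_univ a)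
  have hφb : ∀ x a i, |φ x a i| ≤ Real.sqrt B := fun x a i => by
    apply Real.abs_le_sqrt
    exact (Finset.single_le_sum (f := fun i => φ x a i ^ 2) (fun j _ => sq_nonneg _)
      (Finset.mem_univ i)).trans (hB x a)
  have hdb : ∀ (v : Fin d → ℝ) x a, |v ⬝ᵥ φ x a| ≤ ∑ i, |v i| * Real.sqrt B := fun v x a => by
    refine (Finset.abs_sum_le_sum_abs _ _).trans (Finset.sum_le_sum fun i _ => ?_)
    rw [abs_mul]
    exact mul_le_mul_of_nonneg_left (hφb x a i) (abs_nonneg _)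
  -- the sample
  set ξ : ℕ → Ω → 𝒳 × 𝒜 := fun t ω => (X t ω, AB t ω) with hξ
  have hξm : ∀ t, Measurable (ξ t) := fun t => (hX_meas t).prodMk (hAB_meas t)
  set r : ℕ → 𝒳 → 𝒜 → ℝ := fun t x a => θ t ⬝ᵥ φ x a with hr
  have hr01 : ∀ t x a, 0 ≤ r t x a ∧ r t x a ≤ 1 := fun t x a => hθ t x a
  set u : 𝒳 → 𝒜 → Fin d → ℝ := fun x a => φ x a ᵥ* V⁻¹ with hu
  set G : ℕ → 𝒳 → 𝒜 → 𝒳 × 𝒜 → ℝ := fun t x a z => (u x a ⬝ᵥ φ z.1 z.2) * r t z.1 z.2 with hG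
  have hGz : ∀ t x a ω, ∑ i, θhat t ω i * φ x a i = G t x a (ξ t ω) := by
    intro t x a ω
    have e1 : (fun i => φ (X t ω) (AB t ω) i * RB t ω) = RB t ω • φ (X t ω) (AB t ω) := by
      ext i; simp [mul_comm]
    have e2 : RB t ω = r t (X t ω) (AB t ω) := hRB t ω
    change θhat t ω ⬝ᵥ φ x a = _
    rw [hθhat, e1, mulVec_smul, smul_dotProduct, dotProduct_comm, dotProduct_mulVec, e2, smul_eq_mul,
      mul_comm]
  have hub : ∀ x a y b, |u x a ⬝ᵥ φ y b| * η ≤ 1 / 2 := fun x a y b =>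
    aux_matrix V hHerm hdet η B hηp hlammin _ _ (hB x a) (hB y b)
  have hGb : ∀ t x a z, |G t x a z| * η ≤ 1 / 2 := by
    intro t x a z
    have h1 := hub x a z.1 z.2
    obtain ⟨h2, h3⟩ := hr01 t z.1 z.2
    rw [hG]
    simp only [abs_mul, abs_of_nonneg h2]
    refine le_trans ?_ h1
    refine mul_le_mul_of_nonneg_right ?_ hηp.le
    exact mul_le_of_le_one_right (abs_nonneg _) h3
  have hGb' : ∀ t x a z, |G t x a z| ≤ 1 / 2 / η := fun t x a z => by
    rw [le_div_iff₀ hηp]; exact hGb t x a z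
  have hub' : ∀ x a y b, |u x a ⬝ᵥ φ y b| ≤ 1 / 2 / η := fun x a y b => by
    rw [le_div_iff₀ hηp]; exact hub x a y b
  -- measurability
  have hφm : ∀ i, Measurable fun z : 𝒳 × 𝒜 => φ z.1 z.2 i := fun i =>
    measurable_from_prod_countable_left fun a => hφ_meas a i
  have hum : ∀ a i, Measurable fun x => u x a i := by
    intro a i
    simp only [hu, vecMul, dotProduct]
    exact Finset.measurable_sum _ fun j _ => (hφ_meas a j).mul_const _
  have hrm : ∀ t a, Measurable fun x => r t x a := by
    intro t a
    simp only [hr, dotProduct]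
    exact Finset.measurable_sum _ fun j _ => (hφ_meas a j).const_mul _
  have hrm' : ∀ t, Measurable fun z : 𝒳 × 𝒜 => r t z.1 z.2 := by
    intro t
    simp only [hr, dotProduct]
    exact Finset.measurable_sum _ fun j _ => (hφm j).const_mul _
  have hGm : ∀ t a, Measurable fun p : 𝒳 × (𝒳 × 𝒜) => G t p.1 a p.2 := by
    intro t a
    simp only [hG]
    refine Measurable.mul ?_ ((hrm' t).comp measurable_snd)
    simp only [dotProduct]
    exact Finset.measurable_sum _ fun j _ =>
      ((hum a j).comp measurable_fst).mul ((hφm j).comp measurable_snd)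
  -- histories
  set hist : ∀ t, Ω → (Finset.range t → 𝒳 × 𝒜) := fun t ω k => ξ k ω with hhist
  have hhm : ∀ t, Measurable (hist t) := fun t => measurable_pi_lambda _ fun k => hξm k
  have hind : ∀ t, IndepFun (hist t) (ξ t) μ := by
    intro t
    have h1 := h_indep.indepFun_finset (Finset.range t) {t} (by simp) hξm
    exact h1.comp (φ := id) (ψ := fun f : (({t} : Finset ℕ) → 𝒳 × 𝒜) => f ⟨t, by simp⟩) measurable_id
      (measurable_pi_apply _)
  set W : ∀ t, 𝒳 → 𝒜 → (Finset.range t → 𝒳 × 𝒜) → ℝ :=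
    fun t x a h => ∏ k : Finset.range t, (1 + η * G k x a (h k)) with hW
  set P : ∀ t, 𝒳 → 𝒜 → (Finset.range t → 𝒳 × 𝒜) → ℝ :=
    fun t x a h => W t x a h / ∑ b, W t x b h with hP
  have hwW : ∀ t x a ω, w t x a ω = W t x a (hist t ω) := by
    intro t x a ω
    rw [hw, hW]
    simp only [hGz]
    exact (Finset.prod_coe_sort (Finset.range t) (fun k => 1 + η * G k x a (ξ k ω))).symm
  have hpP : ∀ t x a ω, pol t x a ω = P t x a (hist t ω) := by
    intro t x a ω
    simp only [hpol, hwW, hP]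
  have hWpos : ∀ t x a h, 0 < W t x a h := by
    intro t x a h
    refine Finset.prod_pos fun k _ => ?_
    have h1 := hGb k x a (h k)
    have h2 := neg_abs_le (G k x a (h k))
    nlinarith
  have hP01 : ∀ t x a h, 0 ≤ P t x a h ∧ P t x a h ≤ 1 := by
    intro t x a h
    have h1 : W t x a h ≤ ∑ b, W t x b h :=
      Finset.single_le_sum (f := fun b => W t x b h) (fun b _ => (hWpos t x b h).le) (Finset.mem_univ a)
    have h2 := hWpos t x a h
    exact ⟨div_nonneg h2.le (h2.le.trans h1), div_le_one_of_le₀ h1 (h2.le.trans h1)⟩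
  have hWm : ∀ t a, Measurable fun p : 𝒳 × (Finset.range t → 𝒳 × 𝒜) => W t p.1 a p.2 := by
    intro t a
    simp only [hW]
    refine Finset.measurable_prod _ fun k _ => Measurable.const_add (Measurable.const_mul ?_ _) _
    exact (hGm k a).comp (measurable_fst.prodMk ((measurable_pi_apply k).comp measurable_snd))
  have hPm : ∀ t a, Measurable fun p : 𝒳 × (Finset.range t → 𝒳 × 𝒜) => P t p.1 a p.2 := by
    intro t a
    simp only [hP]
    exact (hWm t a).div (Finset.measurable_sum _ fun b _ => hWm t b)
  have hdP : ∀ t x a h, |πstar x a - P t x a h| ≤ 1 := by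
    intro t x a h
    have h1 := hP01 t x a h
    have h2 := hπstar_nonneg x a
    have h3 := hsle x a
    rw [abs_le]; constructor <;> linarith [h1.1, h1.2]
  -- laws
  have hlaw : ∀ t (g : 𝒳 → 𝒜 → ℝ), (∀ a, Measurable fun x => g x a) → ∀ C : ℝ, (∀ x a, |g x a| ≤ C) →
      ∫ ω, g (X t ω) (AB t ω) ∂μ = ∫ x, ∑ a, πB x a * g x a ∂ν := fun t g hg C hC =>
    aux_law μ ν πB hπB_nonneg hπB_sum hπB_meas (X t) (AB t) (hX_meas t) (hAB_meas t) (h_law t) g hg C hC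
  have hmapX : ∀ t, μ.map (X t) = ν := by
    intro t
    ext S hS
    rw [Measure.map_apply (hX_meas t) hS]
    have e1 : X t ⁻¹' S = ⋃ a, {ω | X t ω ∈ S ∧ AB t ω = a} := by ext ω; simp
    rw [e1, measure_iUnion]
    · rw [tsum_fintype]
      simp only [h_law t S hS]
      rw [← lintegral_finsetSum _ fun a _ => (hπB_meas a).ennreal_ofReal]
      have e2 : ∀ x, ∑ a, ENNReal.ofReal (πB x a) = 1 := fun x => by
        rw [← ENNReal.ofReal_sum_of_nonneg fun a _ => hπB_nonneg x a, hπB_sum, ENNReal.ofReal_one]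
      simp [e2]
    · intro a b hab
      rw [Function.onFun, Set.disjoint_left]
      rintro ω ⟨_, h1⟩ ⟨_, h2⟩
      exact hab (h1.symm.trans h2)
    · intro a
      exact (hX_meas t hS).inter (hAB_meas t (measurableSet_singleton a))
  have hbil : ∀ t (v v' : Fin d → ℝ), ∫ ω, (v ⬝ᵥ φ (X t ω) (AB t ω)) * (v' ⬝ᵥ φ (X t ω) (AB t ω)) ∂μ
      = v ⬝ᵥ V *ᵥ v' := by
    intro t v v'
    have e1 : ∀ x a, (v ⬝ᵥ φ x a) * (v' ⬝ᵥ φ x a) = ∑ i, ∑ j, v i * (φ x a i * φ x a j) * v' j := by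
      intro x a
      simp only [dotProduct]
      rw [Finset.sum_mul_sum]
      exact Finset.sum_congr rfl fun i _ => Finset.sum_congr rfl fun j _ => by ring
    have hφφ : ∀ x a i j, |φ x a i * φ x a j| ≤ B := by
      intro x a i j
      rw [abs_mul, ← Real.mul_self_sqrt hB0]
      exact mul_le_mul (hφb x a i) (hφb x a j) (abs_nonneg _) (Real.sqrt_nonneg _)
    have hint : ∀ i j, Integrable (fun ω => φ (X t ω) (AB t ω) i * φ (X t ω) (AB t ω) j) μ := by
      intro i j
      exact Integrable.of_bound (C := B)
        (((hφm i).comp (hξm t)).mul ((hφm j).comp (hξm t))).aestronglyMeasurable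
        (.of_forall fun ω => hφφ _ _ i j)
    simp only [e1]
    rw [integral_finsetSum _ fun i _ => integrable_finsetSum _ fun j _ => ((hint i j).const_mul _).mul_const _]
    simp only [dotProduct, mulVec, Finset.mul_sum]
    refine Finset.sum_congr rfl fun i _ => ?_
    rw [integral_finsetSum _ fun j _ => ((hint i j).const_mul _).mul_const _]
    refine Finset.sum_congr rfl fun j _ => ?_
    rw [integral_mul_const, integral_const_mul, hVdef, hVbar,
      hlaw t (fun x a => φ x a i * φ x a j) (fun a => (hφ_meas a i).mul (hφ_meas a j)) B
        (fun x a => hφφ x a i j)]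
    ring
  have hEG : ∀ t x a, ∫ ω, G t x a (ξ t ω) ∂μ = r t x a := by
    intro t x a
    refine (hbil t (u x a) (θ t)).trans ?_
    simp only [hu, hr]
    rw [dotProduct_mulVec, vecMul_vecMul, nonsing_inv_mul _ hVu, vecMul_one, dotProduct_comm]
  have hGint : ∀ t x a, Integrable (fun ω => G t x a (ξ t ω)) μ := fun t x a =>
    Integrable.of_bound (C := 1/2/η)
      ((hGm t a).comp (measurable_const.prodMk (hξm t))).aestronglyMeasurable
      (.of_forall fun ω => hGb' _ _ _ _)
  have hG2int : ∀ t x a, Integrable (fun ω => G t x a (ξ t ω) ^ 2) μ := fun t x a =>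
    Integrable.of_bound (C := (1/2/η)^2)
      (((hGm t a).comp (measurable_const.prodMk (hξm t))).pow_const 2).aestronglyMeasurable
      (.of_forall fun ω => by
        rw [norm_pow]; exact pow_le_pow_left₀ (norm_nonneg _) (hGb' _ _ _ _) 2)
  have hEG2 : ∀ t x a, ∫ ω, G t x a (ξ t ω) ^ 2 ∂μ ≤ u x a ⬝ᵥ φ x a := by
    intro t x a
    have h1 := hbil t (u x a) (u x a)
    have e1 : u x a ⬝ᵥ V *ᵥ u x a = u x a ⬝ᵥ φ x a := by
      have : V *ᵥ u x a = φ x a := by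
        conv_lhs => rw [← hVs]
        rw [mulVec_transpose]
        simp only [hu]
        rw [vecMul_vecMul, nonsing_inv_mul _ hVu, vecMul_one]
      rw [this]
    rw [← e1, ← h1]
    refine integral_mono (hG2int t x a) ?_ fun ω => ?_
    · refine Integrable.of_bound (C := (1/2/η) * (1/2/η)) ?_ (.of_forall fun ω => ?_)
      · have : Measurable fun ω => u x a ⬝ᵥ φ (X t ω) (AB t ω) := by
          simp only [dotProduct]
          exact Finset.measurable_sum _ fun j _ => ((hφm j).comp (hξm t)).const_mul _
        exact (this.mul this).aestronglyMeasurable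
      · rw [norm_mul]
        exact mul_le_mul (hub' _ _ _ _) (hub' _ _ _ _) (norm_nonneg _) (by positivity)
    · simp only [hG]
      obtain ⟨h2, h3⟩ := hr01 t (ξ t ω).1 (ξ t ω).2
      rw [mul_pow, sq (u x a ⬝ᵥ _)]
      refine mul_le_of_le_one_right (mul_self_nonneg _) ?_
      exact pow_le_one₀ h2 h3
  -- the instantaneous regret
  set f : ∀ t, 𝒳 → (Finset.range t → 𝒳 × 𝒜) → ℝ :=
    fun t x h => ∑ a, (πstar x a - P t x a h) * r t x a with hf
  have hfm : ∀ t, Measurable fun p : 𝒳 × (Finset.range t → 𝒳 × 𝒜) => f t p.1 p.2 := by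
    intro t
    simp only [hf]
    exact Finset.measurable_sum _ fun a _ =>
      (((hπstar_meas a).comp measurable_fst).sub (hPm t a)).mul ((hrm t a).comp measurable_fst)
  have hfb : ∀ t x h, |f t x h| ≤ Fintype.card 𝒜 := by
    intro t x h
    refine (Finset.abs_sum_le_sum_abs _ _).trans ?_
    refine (Finset.sum_le_sum (g := fun _ => (1:ℝ)) fun a _ => ?_).trans (by simp)
    rw [abs_mul, abs_of_nonneg (hr01 t x a).1]
    exact mul_le_one₀ (hdP t x a h) (hr01 t x a).1 (hr01 t x a).2
  have hfp : ∀ t, Integrable (fun p : 𝒳 × Ω => f t p.1 (hist t p.2)) (ν.prod μ) := fun t =>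
    Integrable.of_bound (C := Fintype.card 𝒜)
      ((hfm t).comp (measurable_fst.prodMk ((hhm t).comp measurable_snd))).aestronglyMeasurable
      (.of_forall fun ω => hfb _ _ _)
  have hstep1 : ∀ t, ∫ ω, f t (X t ω) (hist t ω) ∂μ = ∫ x, ∫ ω, f t x (hist t ω) ∂μ ∂ν := by
    intro t
    have hi : IndepFun (hist t) (X t) μ := (hind t).comp (φ := id) (ψ := Prod.fst) measurable_id measurable_fst
    have h1 := aux_indep μ (hist t) (X t) (hhm t) (hX_meas t) hi (fun h x => f t x h)
      ((hfm t).comp measurable_swap) _ (fun h x => hfb t x h)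
    rw [h1, hmapX, ← integral_integral_swap]
    exact hfp t
  have hstep2 : ∀ t x, ∫ ω, f t x (hist t ω) ∂μ
      = ∫ ω, ∑ a, (πstar x a - P t x a (hist t ω)) * G t x a (ξ t ω) ∂μ := by
    intro t x
    rw [aux_indep μ (hist t) (ξ t) (hhm t) (hξm t) (hind t)
      (fun h z => ∑ a, (πstar x a - P t x a h) * G t x a z) ?_ (∑ a : 𝒜, 1 * (1/2/η)) ?_]
    · refine integral_congr_ae (.of_forall fun ω => ?_)
      simp only [hf]
      rw [integral_map (hξm t).aemeasurable]
      · rw [integral_finsetSum _ fun a _ => (hGint t x a).const_mul _]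
        refine Finset.sum_congr rfl fun a _ => ?_
        rw [integral_const_mul, hEG]
      · exact (Finset.measurable_sum _ fun a _ =>
          ((hGm t a).comp (measurable_const.prodMk measurable_id)).const_mul _).aestronglyMeasurable
    · refine Finset.measurable_sum _ fun a _ => Measurable.mul ?_ ?_
      · exact ((hPm t a).comp (measurable_const.prodMk measurable_fst)).const_sub _
      · exact (hGm t a).comp (measurable_const.prodMk measurable_snd)
    · intro h z
      refine (Finset.abs_sum_le_sum_abs _ _).trans (Finset.sum_le_sum fun a _ => ?_)
      rw [abs_mul]
      exact mul_le_mul (hdP t x a h) (hGb' t x a z) (abs_nonneg _) zero_le_one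
  have hzint : ∀ t x, Integrable (fun ω => ∑ a, (πstar x a - P t x a (hist t ω)) * G t x a (ξ t ω)) μ := by
    intro t x
    refine integrable_finsetSum _ fun a _ => ?_
    refine (hGint t x a).bdd_mul (c := 1) ?_ (.of_forall fun ω => hdP t x a _)
    exact (((hPm t a).comp (measurable_const.prodMk (hhm t))).const_sub _).aestronglyMeasurable
  have hstep3 : ∀ x, ∑ t ∈ Finset.range n, ∫ ω, f t x (hist t ω) ∂μ ≤
      Real.log K / η + η * (n * ∑ a, πstar x a * (u x a ⬝ᵥ φ x a)) := by
    intro x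
    simp only [hstep2]
    rw [← integral_finsetSum _ fun t _ => hzint t x]
    have hq2 : Integrable (fun ω => ∑ t ∈ Finset.range n, ∑ a, πstar x a * G t x a (ξ t ω) ^ 2) μ :=
      integrable_finsetSum _ fun t _ => integrable_finsetSum _ fun a _ => (hG2int t x a).const_mul _
    calc _ ≤ ∫ ω, (Real.log K / η + η * ∑ t ∈ Finset.range n, ∑ a, πstar x a * G t x a (ξ t ω) ^ 2) ∂μ := by
          refine integral_mono (integrable_finsetSum _ fun t _ => hzint t x)
            ((integrable_const _).add (hq2.const_mul _)) fun ω => ?_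
          have := aux_det n η hηp (fun t a => G t x a (ξ t ω)) (fun t a => hGb _ _ _ _)
            (fun t a => W t x a (hist t ω)) (fun t a => P t x a (hist t ω))
            (fun t a => by
              rw [← hwW, hw]; simp only [hGz]) (fun t a => rfl) (πstar x) (hπstar_nonneg x) (hπstar_sum x)
          rw [← hK] at this
          exact this
      _ = Real.log K / η + η * ∑ t ∈ Finset.range n, ∑ a, πstar x a * ∫ ω, G t x a (ξ t ω) ^ 2 ∂μ := by
          rw [integral_add (integrable_const _) (hq2.const_mul _), integral_const_mul,
            integral_finsetSum _ fun t _ => integrable_finsetSum _ fun a _ => (hG2int t x a).const_mul _]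
          simp only [integral_const, probReal_univ, one_smul]
          congr 2
          refine Finset.sum_congr rfl fun t _ => ?_
          rw [integral_finsetSum _ fun a _ => (hG2int t x a).const_mul _]
          simp only [integral_const_mul]
      _ ≤ Real.log K / η + η * ∑ t ∈ Finset.range n, ∑ a, πstar x a * (u x a ⬝ᵥ φ x a) := by
          gcongr with t _ a _
          · exact hπstar_nonneg x a
          · exact hEG2 t x a
      _ = _ := by simp
  -- trace identity
  have hφφν : ∀ a i j, Integrable (fun x => πstar x a * (φ x a i * φ x a j)) ν := by
    intro a i j
    refine Integrable.of_bound (C := 1 * (Real.sqrt B * Real.sqrt B))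
      ((hπstar_meas a).mul ((hφ_meas a i).mul (hφ_meas a j))).aestronglyMeasurable (.of_forall fun x => ?_)
    rw [norm_mul, norm_mul]
    refine mul_le_mul ?_ ?_ (by positivity) zero_le_one
    · rw [Real.norm_eq_abs, abs_of_nonneg (hπstar_nonneg x a)]; exact hsle x a
    · exact mul_le_mul (hφb x a i) (hφb x a j) (abs_nonneg _) (Real.sqrt_nonneg _)
  have huφ : ∀ x, ∑ a, πstar x a * (u x a ⬝ᵥ φ x a) =
      ∑ i, ∑ j, V⁻¹ i j * ∑ a, πstar x a * (φ x a j * φ x a i) := by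
    intro x
    have e0 : ∀ a, u x a ⬝ᵥ φ x a = ∑ i, φ x a i * ∑ j, V⁻¹ i j * φ x a j := fun a =>
      (dotProduct_mulVec (φ x a) V⁻¹ (φ x a)).symm
    simp only [e0, Finset.mul_sum]
    rw [Finset.sum_comm]
    refine Finset.sum_congr rfl fun i _ => ?_
    rw [Finset.sum_comm]
    exact Finset.sum_congr rfl fun j _ => Finset.sum_congr rfl fun a _ => by ring
  have hI : ∀ i j, Integrable (fun x => V⁻¹ i j * ∑ a, πstar x a * (φ x a j * φ x a i)) ν :=
    fun i j => (integrable_finsetSum _ fun a _ => hφφν a j i).const_mul _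
  have hI2 : ∀ i, Integrable (fun x => ∑ j, V⁻¹ i j * ∑ a, πstar x a * (φ x a j * φ x a i)) ν :=
    fun i => integrable_finsetSum _ fun j _ => hI i j
  have hIn : Integrable (fun x => ∑ a, πstar x a * (u x a ⬝ᵥ φ x a)) ν := by
    simp only [huφ]
    exact integrable_finsetSum _ fun i _ => hI2 i
  have htr : ∫ x, ∑ a, πstar x a * (u x a ⬝ᵥ φ x a) ∂ν = Cφ := by
    simp only [huφ]
    refine (integral_finsetSum _ fun i _ => hI2 i).trans ?_
    rw [hCφ]
    simp only [trace, diag, mul_apply]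
    refine Finset.sum_congr rfl fun i _ => ?_
    refine (integral_finsetSum _ fun j _ => hI i j).trans ?_
    refine Finset.sum_congr rfl fun j _ => ?_
    rw [integral_const_mul, hVbar]
  have hconst1 : Real.log K / η = Real.sqrt (n * Real.log K) := by
    rw [div_eq_iff hηp.ne', hη, ← Real.sqrt_mul (by positivity)]
    rw [show (n * Real.log K) * (Real.log K / n) = Real.log K ^ 2 by field_simp]
    exact (Real.sqrt_sq hlogK.le).symm
  have hconst2 : η * n = Real.sqrt (n * Real.log K) := by
    rw [← hconst1, eq_div_iff hηp.ne']
    have : η * η = Real.log K / n := by rw [hη]; exact Real.mul_self_sqrt (by positivity)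
    calc η * n * η = (η * η) * n := by ring
      _ = _ := by rw [this]; field_simp
  have hDint : ∀ t, Integrable (fun x => ∫ ω, f t x (hist t ω) ∂μ) ν := fun t =>
    (hfp t).integral_prod_left
  calc _ = ∫ ω, ∑ t ∈ Finset.range n, f t (X t ω) (hist t ω) ∂μ := by
        simp only [hpP, hf, hr, dotProduct]
    _ = ∑ t ∈ Finset.range n, ∫ ω, f t (X t ω) (hist t ω) ∂μ := by
        refine integral_finsetSum _ fun t _ => ?_
        exact Integrable.of_bound (C := Fintype.card 𝒜)
          ((hfm t).comp ((hX_meas t).prodMk (hhm t))).aestronglyMeasurable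
          (.of_forall fun ω => hfb _ _ _)
    _ = ∫ x, ∑ t ∈ Finset.range n, ∫ ω, f t x (hist t ω) ∂μ ∂ν := by
        rw [integral_finsetSum _ fun t _ => hDint t]
        exact Finset.sum_congr rfl fun t _ => hstep1 t
    _ ≤ ∫ x, (Real.log K / η + η * (n * ∑ a, πstar x a * (u x a ⬝ᵥ φ x a))) ∂ν := by
        refine integral_mono (integrable_finsetSum _ fun t _ => hDint t) ?_ hstep3
        exact (integrable_const _).add ((hIn.const_mul _).const_mul _)
    _ = Real.log K / η + η * (n * Cφ) := by
        rw [integral_add (integrable_const _) ((hIn.const_mul _).const_mul _), integral_const_mul,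
          integral_const_mul, htr]
        simp
    _ = _ := by rw [← mul_assoc, hconst2, hconst1]; ring
end
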